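/- arXiv:0708.4327 — 8 statements merged into one kernel-verified Lean document; each statement's English description precedes it below -/
import Mathlib

section
/- Let G be a countable discrete amenable group and let c : G → ℓ²G be a 1-cocycle for the left regular representation. Then c is either bounded (there exists C ≥ 0 with ‖c(g)‖ ≤ C for all g ∈ G) or proper (for every C ≥ 0 the set {g ∈ G : ‖c(g)‖ ≤ C} is finite). -/
open scoped ENNReal

/-- The left regular representation of a group `G` on `ℓ²G = lp (fun _ : G => ℂ) 2`:
`(lreg g f) h = f (g⁻¹ * h)`. -/
noncomputable def lreg {G : Type*} [Group G] (g : G) (f : lp (fun _ : G => ℂ) 2) :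
    lp (fun _ : G => ℂ) 2 :=
  ⟨fun h => f (g⁻¹ * h), by
    show Memℓp (fun h : G => f (g⁻¹ * h)) 2
    rw [memℓp_gen_iff (by norm_num)]
    have hf : Summable fun h : G => ‖f h‖ ^ (2 : ℝ≥0∞).toReal :=
      (memℓp_gen_iff (by norm_num)).1 (lp.memℓp f)
    exact ((Equiv.mulLeft g⁻¹).summable_iff
      (f := fun h : G => ‖f h‖ ^ (2 : ℝ≥0∞).toReal)).2 hf⟩

/-- The constant function `1` as an element of `ℓ∞(G)`, the space of bounded
real-valued functions on `G`. -/
noncomputable def lconstOne (G : Type*) [Group G] : lp (fun _ : G => ℝ) ∞ :=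
  ⟨fun _ => 1, memℓp_infty ⟨1, by rintro x ⟨h, rfl⟩; simp⟩⟩

/-- Left translation on `ℓ∞(G)`: `(ltrans g f) h = f (g⁻¹ * h)`. -/
noncomputable def ltrans {G : Type*} [Group G] (g : G) (f : lp (fun _ : G => ℝ) ∞) :
    lp (fun _ : G => ℝ) ∞ :=
  ⟨fun h => f (g⁻¹ * h), memℓp_infty (BddAbove.mono
    (by rintro x ⟨h, rfl⟩; exact ⟨g⁻¹ * h, rfl⟩)
    (memℓp_infty_iff.1 (lp.memℓp f)))⟩

/-- A left-invariant mean on a group `G`: a linear functional on the space `ℓ∞(G)`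
of bounded real-valued functions on `G` which is normalized (`m 1 = 1`), positive
(`m f ≥ 0` whenever `f ≥ 0`), and invariant under left translation. -/
structure InvariantMean (G : Type*) [Group G] where
  toFun : lp (fun _ : G => ℝ) ∞ →ₗ[ℝ] ℝ
  map_one' : toFun (lconstOne G) = 1
  nonneg' : ∀ f : lp (fun _ : G => ℝ) ∞, (∀ x : G, 0 ≤ f x) → 0 ≤ toFun f
  invariant' : ∀ (g : G) (f : lp (fun _ : G => ℝ) ∞), toFun (ltrans g f) = toFun f


open scoped Pointwise in
theorem pow_mul_card_le_card_pow_mul {G : Type*} [Group G] [DecidableEq G] {Ω : Finset G} {q : ℝ}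
    (hq : 0 ≤ q) (hΩ : ∀ F : Finset G, q * F.card ≤ (Ω * F).card) (k : ℕ) (F : Finset G) :
    q ^ k * F.card ≤ (Ω ^ k * F).card := by
  induction k with
  | zero => simp
  | succ k ih =>
    calc q ^ (k + 1) * F.card = q * (q ^ k * F.card) := by ring
      _ ≤ q * (Ω ^ k * F).card := by gcongr
      _ ≤ (Ω * (Ω ^ k * F)).card := hΩ _
      _ = (Ω ^ (k + 1) * F).card := by rw [← mul_assoc, pow_succ']

/-- The indicator function of a set as an element of `ℓ∞(G)`. -/
noncomputable def lindicator {G : Type*} (A : Set G) : lp (fun _ : G => ℝ) ∞ :=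
  ⟨A.indicator 1, memℓp_infty ⟨1, by
    rintro _ ⟨x, rfl⟩
    by_cases hx : x ∈ A <;> simp [hx]⟩⟩

open scoped Classical in
theorem lindicator_apply {G : Type*} (A : Set G) (x : G) :
    lindicator A x = if x ∈ A then 1 else 0 :=
  Set.indicator_apply _ _ _

theorem ltrans_apply {G : Type*} [Group G] (g : G) (f : lp (fun _ : G => ℝ) ∞) (x : G) :
    ltrans g f x = f (g⁻¹ * x) :=
  rfl

/-- A group with an invariant mean admits no injection `G × Bool → G` which moves points by left
multiplication by elements of a fixed finite set. -/
theorem InvariantMean.not_paradoxical {G : Type*} [Group G] (m : InvariantMean G) (Ω : Finset G)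
    (φ : G × Bool → G) (hφ : Function.Injective φ) (hΩ : ∀ z, φ z * z.1⁻¹ ∈ Ω) : False := by
  classical
  let A : G → Bool → Set G := fun s i => {x | φ (x, i) = s * x}
  have hcover (i : Bool) : ∑ s ∈ Ω, lindicator (A s i) = lconstOne G := by
    ext x
    have : ∀ s ∈ Ω, lindicator (A s i) x = if φ (x, i) * x⁻¹ = s then 1 else 0 := by
      intro s _
      simp [lindicator_apply, A, mul_inv_eq_iff_eq_mul]
    rw [lp.coeFn_sum, Finset.sum_apply, Finset.sum_congr rfl this,
      Finset.sum_ite_eq, if_pos (hΩ (x, i))]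
    rfl
  have hpack (y : G) :
      ∑ p ∈ Ω ×ˢ (Finset.univ : Finset Bool), ltrans p.1 (lindicator (A p.1 p.2)) y ≤ 1 := by
    have hval : ∀ p ∈ Ω ×ˢ (Finset.univ : Finset Bool), ltrans p.1 (lindicator (A p.1 p.2)) y =
        if φ (p.1⁻¹ * y, p.2) = y then 1 else 0 := by
      intro p _
      simp [ltrans_apply, lindicator_apply, A]
    rw [Finset.sum_congr rfl hval, Finset.sum_boole]
    refine Nat.cast_le_one.2 (Finset.card_le_one.2 ?_)
    intro p hp q hq
    simp only [Finset.mem_filter] at hp hq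
    have h := hφ (hp.2.trans hq.2.symm)
    simp only [Prod.mk.injEq, mul_left_inj, inv_inj] at h
    exact Prod.ext h.1 h.2
  have hsum : m.toFun (∑ p ∈ Ω ×ˢ (Finset.univ : Finset Bool),
      ltrans p.1 (lindicator (A p.1 p.2))) = 2 := by
    rw [map_sum, Finset.sum_product_right]
    calc ∑ i : Bool, ∑ s ∈ Ω, m.toFun (ltrans s (lindicator (A s i)))
        = ∑ i : Bool, m.toFun (lconstOne G) := by
          refine Finset.sum_congr rfl fun i _ => ?_
          rw [← hcover i, map_sum]
          exact Finset.sum_congr rfl fun s _ => m.invariant' s _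
      _ = 2 := by simp [m.map_one']
  have hnonneg := m.nonneg' (lconstOne G - ∑ p ∈ Ω ×ˢ (Finset.univ : Finset Bool),
      ltrans p.1 (lindicator (A p.1 p.2))) fun y => by
    have hy : (∑ p ∈ Ω ×ˢ (Finset.univ : Finset Bool),
        ltrans p.1 (lindicator (A p.1 p.2)) : lp (fun _ : G => ℝ) ∞) y ≤ 1 := by
      rw [lp.coeFn_sum, Finset.sum_apply]
      exact hpack y
    exact sub_nonneg.2 hy
  rw [map_sub, m.map_one', hsum] at hnonneg
  norm_num at hnonneg

open scoped Pointwise in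
/-- The Følner condition for a group with an invariant mean. -/
theorem InvariantMean.exists_card_mul_le {G : Type*} [Group G] [DecidableEq G]
    (m : InvariantMean G) (Ω : Finset G) {ε : ℝ} (hε : 0 < ε) :
    ∃ F : Finset G, F.Nonempty ∧ ((Ω * F).card : ℝ) ≤ (1 + ε) * F.card := by
  by_contra! h
  have hΩ (F : Finset G) : (1 + ε) * F.card ≤ (Ω * F).card := by
    rcases F.eq_empty_or_nonempty with rfl | hF
    · simp
    · exact (h F hF).le
  obtain ⟨k, hk⟩ := pow_unbounded_of_one_lt 2 (lt_add_of_pos_right 1 hε)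
  have hdouble (F : Finset G) : 2 * F.card ≤ (Ω ^ k * F).card := by
    have := pow_mul_card_le_card_pow_mul (by positivity) hΩ k F
    have h2 : (2 : ℝ) * F.card ≤ (1 + ε) ^ k * F.card := by gcongr
    exact_mod_cast h2.trans this
  have hall (T : Finset (G × Bool)) :
      T.card ≤ (T.biUnion fun z => Ω ^ k * {z.1}).card := by
    have hT : T ⊆ T.image Prod.fst ×ˢ Finset.univ := fun z hz =>
      Finset.mem_product.2 ⟨Finset.mem_image_of_mem _ hz, Finset.mem_univ _⟩
    calc T.card ≤ 2 * (T.image Prod.fst).card := by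
          refine (Finset.card_le_card hT).trans_eq ?_
          simp [Finset.card_product, mul_comm]
      _ ≤ (Ω ^ k * T.image Prod.fst).card := hdouble _
      _ ≤ _ := by
          refine Finset.card_le_card fun y hy => ?_
          obtain ⟨s, hs, x, hx, rfl⟩ := Finset.mem_mul.1 hy
          obtain ⟨z, hz, rfl⟩ := Finset.mem_image.1 hx
          exact Finset.mem_biUnion.2 ⟨z, hz, Finset.mul_mem_mul hs (Finset.mem_singleton_self _)⟩
  obtain ⟨φ, hφ, hmem⟩ := (Finset.all_card_le_biUnion_card_iff_exists_injective _).1 hall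
  refine m.not_paradoxical (Ω ^ k) φ hφ fun z => ?_
  obtain ⟨s, hs, x, hx, hsx⟩ := Finset.mem_mul.1 (hmem z)
  rw [Finset.mem_singleton] at hx
  rw [← hsx, hx, mul_inv_cancel_right]
  exact hs

/-- The sum of the squared lengths of the projections of an orthonormal family to a
finite-dimensional subspace is at most the dimension of the subspace. -/
theorem Orthonormal.sum_sq_norm_inner_le_finrank {ι E : Type*} [Fintype ι] [NormedAddCommGroup E]
    [InnerProductSpace ℂ E] {e p : ι → E} (he : Orthonormal ℂ e) (U : Submodule ℂ E)
    [FiniteDimensional ℂ U] (hpU : ∀ i, p i ∈ U) (hp : ∀ i, ‖p i‖ ≤ 1) :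
    ∑ i, ‖inner ℂ (e i) (p i)‖ ^ 2 ≤ Module.finrank ℂ U := by
  let u := stdOrthonormalBasis ℂ U
  have hproj (i : ι) : ‖inner ℂ (e i) (p i)‖ ^ 2 ≤ ∑ j, ‖inner ℂ (e i) (u j : E)‖ ^ 2 := by
    have h1 : inner ℂ (e i) (p i) = inner ℂ (U.orthogonalProjectionOnto (e i)) (⟨p i, hpU i⟩ : U) :=
      (Submodule.inner_orthogonalProjectionOnto_eq_of_mem_right ⟨p i, hpU i⟩ (e i)).symm
    have h2 : ‖inner ℂ (e i) (p i)‖ ≤ ‖U.orthogonalProjectionOnto (e i)‖ := by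
      rw [h1]
      refine (norm_inner_le_norm _ _).trans (mul_le_of_le_one_right (norm_nonneg _) (hp i))
    calc ‖inner ℂ (e i) (p i)‖ ^ 2 ≤ ‖U.orthogonalProjectionOnto (e i)‖ ^ 2 := by gcongr
      _ = ∑ j, ‖inner ℂ (U.orthogonalProjectionOnto (e i)) (u j)‖ ^ 2 :=
        (u.sum_sq_norm_inner_left _).symm
      _ = _ := by
        simp_rw [Submodule.inner_orthogonalProjectionOnto_eq_of_mem_right]
  calc ∑ i, ‖inner ℂ (e i) (p i)‖ ^ 2 ≤ ∑ i, ∑ j, ‖inner ℂ (e i) (u j : E)‖ ^ 2 :=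
        Finset.sum_le_sum fun i _ => hproj i
    _ = ∑ j, ∑ i, ‖inner ℂ (e i) (u j : E)‖ ^ 2 := Finset.sum_comm
    _ ≤ ∑ j : Fin (Module.finrank ℂ U), (1 : ℝ) := Finset.sum_le_sum fun j _ => by
        refine (he.sum_inner_products_le (s := Finset.univ) (u j : E)).trans ?_
        rw [← Submodule.coe_norm, u.norm_eq_one, one_pow]
    _ = _ := by simp

/-- Precomposition with a permutation, as a linear isometry of `ℓ²`. -/
noncomputable def lreindex {G : Type*} (σ : G ≃ G) :
    lp (fun _ : G => ℂ) 2 →ₗᵢ[ℂ] lp (fun _ : G => ℂ) 2 where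
  toFun f := ⟨fun h => f (σ h), by
    show Memℓp (fun h : G => f (σ h)) 2
    rw [memℓp_gen_iff (by norm_num)]
    exact (σ.summable_iff (f := fun h : G => ‖f h‖ ^ (2 : ℝ≥0∞).toReal)).2
      ((memℓp_gen_iff (by norm_num)).1 (lp.memℓp f))⟩
  map_add' _ _ := rfl
  map_smul' _ _ := rfl
  norm_map' f := by
    rw [lp.norm_eq_tsum_rpow (by norm_num), lp.norm_eq_tsum_rpow (by norm_num)]
    congr 1
    exact σ.tsum_eq fun h => ‖f h‖ ^ (2 : ℝ≥0∞).toReal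

theorem lreindex_apply {G : Type*} (σ : G ≃ G) (f : lp (fun _ : G => ℂ) 2) (x : G) :
    lreindex σ f x = f (σ x) :=
  rfl

theorem lreindex_mulLeft_inv {G : Type*} [Group G] (g : G) (f : lp (fun _ : G => ℂ) 2) :
    lreindex (Equiv.mulLeft g⁻¹) f = lreg g f :=
  rfl

theorem lreindex_mulRight_inv_single {G : Type*} [Group G] [DecidableEq G] (t x : G) :
    lreindex (Equiv.mulRight t⁻¹) (lp.single 2 x (1 : ℂ)) = lp.single 2 (x * t) 1 := by
  ext y
  simp [lreindex_apply, lp.single_apply, Pi.single_apply, mul_inv_eq_iff_eq_mul]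

theorem lp.finite_le_norm {G : Type*} (f : lp (fun _ : G => ℂ) 2) {δ : ℝ} (hδ : 0 < δ) :
    {x | δ ≤ ‖f x‖}.Finite := by
  have h : Summable fun x => ‖f x‖ ^ (2 : ℝ≥0∞).toReal :=
    (memℓp_gen_iff (by norm_num)).1 (lp.memℓp f)
  have := h.tendsto_cofinite_zero.eventually_lt_const (show (0 : ℝ) < δ ^ 2 by positivity)
  refine (Filter.eventually_cofinite.1 this).subset fun x hx => ?_
  simp only [ENNReal.toReal_ofNat, Real.rpow_two, Set.mem_ofPred_eq, not_lt] at hx ⊢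
  gcongr

/-- Finitely supported functions with zero sum are dense in `ℓ²` of an infinite set. -/
theorem exists_sum_eq_zero_norm_sub_single_le {G : Type*} [DecidableEq G] [Infinite G] (x : G)
    {ε : ℝ} (hε : 0 < ε) :
    ∃ f : G →₀ ℂ, Finsupp.linearCombination ℂ (fun _ : G => (1 : ℂ)) f = 0 ∧
      ‖Finsupp.linearCombination ℂ (fun x : G => lp.single (E := fun _ : G => ℂ) 2 x (1 : ℂ)) f -
        lp.single 2 x 1‖ ≤ ε := by
  let ι := Finsupp.linearCombination ℂ (fun x : G => lp.single (E := fun _ : G => ℂ) 2 x (1 : ℂ))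
  let I := LinearMap.ker (Finsupp.linearCombination ℂ (fun _ : G => (1 : ℂ)))
  have hdense : (I.map ι).topologicalClosure = ⊤ := by
    rw [Submodule.topologicalClosure_eq_top_iff, Submodule.eq_bot_iff]
    intro w hw
    have hconst (y z : G) : w y = w z := by
      have hmem : ι (Finsupp.single y 1 - Finsupp.single z 1) ∈ I.map ι :=
        Submodule.mem_map_of_mem (by simp [I])
      have h0 := (Submodule.mem_orthogonal _ _).1 hw _ hmem
      simpa [ι, inner_sub_left, lp.inner_single_left, sub_eq_zero] using h0
    ext y
    by_contra hy
    refine Set.infinite_univ ((lp.finite_le_norm w (norm_pos_iff.2 hy)).subset fun z _ => ?_)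
    exact (congrArg norm (hconst y z)).le
  have hx : lp.single (E := fun _ : G => ℂ) 2 x (1 : ℂ) ∈ closure (I.map ι : Set _) := by
    rw [← Submodule.topologicalClosure_coe, hdense]
    trivial
  obtain ⟨_, ⟨f, hf, rfl⟩, hfx⟩ := Metric.mem_closure_iff.1 hx ε hε
  refine ⟨f, hf, ?_⟩
  rw [dist_comm, dist_eq_norm] at hfx
  exact hfx.le

/-- The equivariance of `f ↦ ∑ x, f x • c x⁻¹` on functions with zero sum. -/
theorem linearCombination_cocycle_mapDomain {G : Type*} [Group G]
    {c : G → lp (fun _ : G => ℂ) 2} (hc : ∀ g h : G, c (g * h) = lreg g (c h) + c g)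
    {f : G →₀ ℂ} (hf : Finsupp.linearCombination ℂ (fun _ : G => (1 : ℂ)) f = 0) (t : G) :
    Finsupp.linearCombination ℂ (fun x => c x⁻¹) (f.mapDomain (· * t)) =
      lreindex (Equiv.mulLeft t) (Finsupp.linearCombination ℂ (fun x => c x⁻¹) f) := by
  have hf' : f.sum (fun _ a => a) = 0 := by simpa [Finsupp.linearCombination_apply] using hf
  rw [Finsupp.linearCombination_mapDomain, Finsupp.linearCombination_apply,
    Finsupp.linearCombination_apply, map_finsuppSum]
  have hx (x : G) : c (x * t)⁻¹ = lreindex (Equiv.mulLeft t) (c x⁻¹) + c t⁻¹ := by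
    rw [mul_inv_rev, hc, ← lreindex_mulLeft_inv, inv_inv]
  simp only [Function.comp_apply, hx, smul_add, Finsupp.sum_add, map_smul]
  rw [show (f.sum fun _ a => a • c t⁻¹) = (f.sum fun _ a => a) • c t⁻¹ from
    (Finset.sum_smul).symm, hf', zero_smul, add_zero]

theorem linearCombination_single_mapDomain {G : Type*} [Group G] [DecidableEq G]
    (f : G →₀ ℂ) (t : G) :
    Finsupp.linearCombination ℂ (fun x : G => lp.single (E := fun _ : G => ℂ) 2 x (1 : ℂ))
        (f.mapDomain (· * t)) =
      lreindex (Equiv.mulRight t⁻¹) (Finsupp.linearCombination ℂ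
        (fun x : G => lp.single (E := fun _ : G => ℂ) 2 x (1 : ℂ)) f) := by
  rw [Finsupp.linearCombination_mapDomain, Finsupp.linearCombination_apply,
    Finsupp.linearCombination_apply, map_finsuppSum]
  simp [lreindex_mulRight_inv_single]

/-- The image of the functions supported in a finite set. -/
theorem finrank_map_supported_le {G V : Type*} [AddCommGroup V] [Module ℂ V] (s : Finset G)
    (Φ : (G →₀ ℂ) →ₗ[ℂ] V) :
    FiniteDimensional ℂ ((Finsupp.supported ℂ ℂ (s : Set G)).map Φ) ∧
      Module.finrank ℂ ((Finsupp.supported ℂ ℂ (s : Set G)).map Φ) ≤ s.card := by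
  let e := Finsupp.supportedEquivFinsupp (M := ℂ) (R := ℂ) (s : Set G)
  have : FiniteDimensional ℂ (Finsupp.supported ℂ ℂ (s : Set G)) := Module.Finite.equiv e.symm
  refine ⟨inferInstance, (Submodule.finrank_map_le Φ _).trans_eq ?_⟩
  rw [e.finrank_eq, Module.finrank_finsupp_self]
  simp

theorem orthonormal_prod_single {G ι : Type*} [DecidableEq G] {σ τ : ι → G}
    (hσ : Function.Injective σ) (hτ : Function.Injective τ) :
    Orthonormal ℂ (Sum.elim
      (fun i => WithLp.toLp 2 (lp.single (E := fun _ : G => ℂ) 2 (σ i) (1 : ℂ),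
        (0 : lp (fun _ : G => ℂ) 2)))
      (fun i => WithLp.toLp 2 ((0 : lp (fun _ : G => ℂ) 2),
        lp.single (E := fun _ : G => ℂ) 2 (τ i) (1 : ℂ)))) := by
  classical
  rw [orthonormal_iff_ite]
  rintro (i | i) (j | j) <;>
    simp [WithLp.prod_inner_apply, lp.inner_single_left, lp.single_apply, Pi.single_apply,
      hσ.eq_iff, hτ.eq_iff]

theorem inner_single_prod_left {G : Type*} [DecidableEq G] (x : G)
    (u v : lp (fun _ : G => ℂ) 2) :
    inner ℂ (WithLp.toLp 2 (lp.single (E := fun _ : G => ℂ) 2 x (1 : ℂ),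
      (0 : lp (fun _ : G => ℂ) 2))) (WithLp.toLp 2 (u, v)) = u x := by
  simp [WithLp.prod_inner_apply, lp.inner_single_left]

theorem inner_single_prod_right {G : Type*} [DecidableEq G] (x : G)
    (u v : lp (fun _ : G => ℂ) 2) :
    inner ℂ (WithLp.toLp 2 ((0 : lp (fun _ : G => ℂ) 2),
      lp.single (E := fun _ : G => ℂ) 2 x (1 : ℂ))) (WithLp.toLp 2 (u, v)) = v x := by
  simp [WithLp.prod_inner_apply, lp.inner_single_left]

set_option maxHeartbeats 1000000 in
open scoped Pointwise in
/-- If the operator `f ↦ ∑ x, f x • c x⁻¹`, defined on finitely supported functions with zero sum,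
takes functions of small norm to vectors close to `w`, then `w` vanishes. -/
theorem apply_eq_zero_of_approx {G : Type*} [Group G] [DecidableEq G] [Infinite G]
    (hfolner : ∀ (Ω : Finset G) (ε : ℝ), 0 < ε →
      ∃ F : Finset G, F.Nonempty ∧ ((Ω * F).card : ℝ) ≤ (1 + ε) * F.card)
    {c : G → lp (fun _ : G => ℂ) 2} (hc : ∀ g h : G, c (g * h) = lreg g (c h) + c g)
    {w : lp (fun _ : G => ℂ) 2} (hw : ‖w‖ ≤ 1 / 2)
    (happrox : ∀ ε : ℝ, 0 < ε → ∃ f : G →₀ ℂ,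
      Finsupp.linearCombination ℂ (fun _ : G => (1 : ℂ)) f = 0 ∧
      ‖Finsupp.linearCombination ℂ (fun x => c x⁻¹) f - w‖ ≤ ε ∧
      ‖Finsupp.linearCombination ℂ
        (fun x : G => lp.single (E := fun _ : G => ℂ) 2 x (1 : ℂ)) f‖ ≤ ε) (y : G) :
    w y = 0 := by
  by_contra hy
  set θ := Finsupp.linearCombination ℂ (fun x => c x⁻¹) with hθ
  set ι := Finsupp.linearCombination ℂ
    (fun x : G => lp.single (E := fun _ : G => ℂ) 2 x (1 : ℂ)) with hι
  have hκ : 0 < ‖w y‖ := norm_pos_iff.2 hy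
  have hκ2 : ‖w y‖ ≤ 1 / 2 := (lp.norm_apply_le_norm (by norm_num) w y).trans hw
  obtain ⟨ε, hε⟩ : ∃ ε, ε = ‖w y‖ ^ 2 / 20 := ⟨_, rfl⟩
  have hε0 : 0 < ε := by rw [hε]; positivity
  have hε1 : ε ≤ 1 / 80 := by rw [hε]; nlinarith
  obtain ⟨h, hh, hhδ⟩ := exists_sum_eq_zero_norm_sub_single_le (1 : G) hε0
  -- Rescale the operator so that it is small on `h`.
  obtain ⟨r, hr0, hrh⟩ : ∃ r : ℝ, 0 < r ∧ r * ‖θ h‖ ≤ ε := by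
    refine ⟨ε / (‖θ h‖ + 1), by positivity, ?_⟩
    rw [div_mul_eq_mul_div, div_le_iff₀ (by positivity)]
    nlinarith [norm_nonneg (θ h)]
  obtain ⟨f₀, hf₀, hf₀w, hf₀ι⟩ := happrox (min ε (r * ε)) (by positivity)
  obtain ⟨f, hf⟩ : ∃ f, f = (r : ℂ)⁻¹ • f₀ := ⟨_, rfl⟩
  have hf0 : Finsupp.linearCombination ℂ (fun _ : G => (1 : ℂ)) f = 0 := by
    rw [hf, map_smul, hf₀, smul_zero]
  have hr0' : (r : ℂ) ≠ 0 := by exact_mod_cast hr0.ne'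
  have hfw : ‖(r : ℂ) • θ f - w‖ ≤ ε := by
    rw [hf, map_smul, smul_inv_smul₀ hr0']
    exact hf₀w.trans (min_le_left _ _)
  have hfι : ‖ι f‖ ≤ ε := by
    rw [hf, map_smul, norm_smul, norm_inv, Complex.norm_real, Real.norm_of_nonneg hr0.le,
      inv_mul_le_iff₀ hr0]
    exact hf₀ι.trans (min_le_right _ _)
  obtain ⟨F, hF, hcard⟩ := hfolner (h.support ∪ f.support) ε hε0
  let Φ := (WithLp.linearEquiv 2 ℂ
    (lp (fun _ : G => ℂ) 2 × lp (fun _ : G => ℂ) 2)).symm.toLinearMap ∘ₗ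
      LinearMap.prod ((r : ℂ) • θ) ι
  have hΦ (f : G →₀ ℂ) : Φ f = WithLp.toLp 2 ((r : ℂ) • θ f, ι f) := rfl
  have hΦnorm {k : G →₀ ℂ} (hk : Finsupp.linearCombination ℂ (fun _ : G => (1 : ℂ)) k = 0)
      (t : G) : ‖Φ (k.mapDomain (· * t))‖ ≤ r * ‖θ k‖ + ‖ι k‖ := by
    have hsplit : Φ (k.mapDomain (· * t)) =
        WithLp.toLp 2 ((r : ℂ) • θ (k.mapDomain (· * t)), 0) +
          WithLp.toLp 2 (0, ι (k.mapDomain (· * t))) := by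
      rw [hΦ, ← WithLp.toLp_add]
      simp
    rw [hsplit]
    refine (norm_add_le _ _).trans_eq ?_
    rw [WithLp.norm_toLp_fst, WithLp.norm_toLp_snd, norm_smul, Complex.norm_real,
      Real.norm_of_nonneg hr0.le, hθ, linearCombination_cocycle_mapDomain hc hk, hι,
      linearCombination_single_mapDomain, LinearIsometry.norm_map, LinearIsometry.norm_map]
  obtain ⟨hfin, hrank⟩ := finrank_map_supported_le ((h.support ∪ f.support) * F) Φ
  have hmem {k : G →₀ ℂ} (hk : k.support ⊆ h.support ∪ f.support) {t : G} (ht : t ∈ F) :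
      Φ (k.mapDomain (· * t)) ∈ (Finsupp.supported ℂ ℂ
        (((h.support ∪ f.support) * F : Finset G) : Set G)).map Φ := by
    refine Submodule.mem_map_of_mem ((Finsupp.mem_supported _ _).2 ?_)
    refine Finset.coe_subset.2 (Finsupp.mapDomain_support.trans fun z hz => ?_)
    obtain ⟨x, hx, rfl⟩ := Finset.mem_image.1 hz
    exact Finset.mul_mem_mul (hk hx) ht
  have hιh : ‖ι h‖ ≤ 1 + ε := by
    have := norm_add_le (ι h - lp.single 2 1 1) (lp.single (E := fun _ : G => ℂ) 2 1 (1 : ℂ))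
    rw [sub_add_cancel, lp.norm_single (by norm_num), norm_one] at this
    linarith
  have hιh1 : 1 - ε ≤ ‖ι h 1‖ := by
    have h1 := (lp.norm_apply_le_norm (by norm_num) (ι h - lp.single 2 1 1) 1).trans hhδ
    have h2 := norm_sub_norm_le (1 : ℂ) (1 - ι h 1)
    rw [lp.coeFn_sub, Pi.sub_apply, lp.single_apply_self, norm_sub_rev] at h1
    rw [sub_sub_cancel, norm_one] at h2
    linarith
  have hθf : r * ‖θ f‖ ≤ 1 / 2 + ε := by
    have := norm_add_le ((r : ℂ) • θ f - w) w
    rw [sub_add_cancel, norm_smul, Complex.norm_real, Real.norm_of_nonneg hr0.le] at this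
    linarith
  have hθfy : ‖w y‖ - ε ≤ ‖((r : ℂ) • θ f) y‖ := by
    have h1 := (lp.norm_apply_le_norm (by norm_num) ((r : ℂ) • θ f - w) y).trans hfw
    have h2 := norm_sub_norm_le (w y) (w y - ((r : ℂ) • θ f) y)
    rw [lp.coeFn_sub, Pi.sub_apply, norm_sub_rev] at h1
    rw [sub_sub_cancel] at h2
    linarith
  -- Compare the trace with the dimension.
  let p : F ⊕ F → WithLp 2 (lp (fun _ : G => ℂ) 2 × lp (fun _ : G => ℂ) 2) :=
    Sum.elim (fun t => Φ (f.mapDomain (· * (t : G))))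
      (fun t => ((1 + 2 * ε : ℝ) : ℂ)⁻¹ • Φ (h.mapDomain (· * (t : G))))
  have hε2 : ‖((1 + 2 * ε : ℝ) : ℂ)⁻¹‖ = (1 + 2 * ε)⁻¹ := by
    rw [norm_inv, Complex.norm_real, Real.norm_of_nonneg (by positivity)]
  have hσ : Function.Injective fun t : F => (t : G)⁻¹ * y := fun a b hab =>
    Subtype.ext (inv_injective (mul_right_cancel hab))
  have hbound := (orthonormal_prod_single hσ
    (Subtype.val_injective (p := (· ∈ F)))).sum_sq_norm_inner_le_finrank (p := p) _
    (by
      rintro (t | t)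
      · exact hmem Finset.subset_union_right t.2
      · exact Submodule.smul_mem _ _ (hmem Finset.subset_union_left t.2))
    (by
      rintro (t | t)
      · exact (hΦnorm hf0 t).trans (by linarith)
      · change ‖_ • _‖ ≤ 1
        rw [norm_smul, hε2, inv_mul_le_iff₀ (by positivity)]
        exact (hΦnorm hh t).trans (by linarith))
  have hleft (t : F) : inner ℂ (WithLp.toLp 2
      (lp.single (E := fun _ : G => ℂ) 2 ((t : G)⁻¹ * y) (1 : ℂ), (0 : lp (fun _ : G => ℂ) 2)))
      (Φ (f.mapDomain (· * (t : G)))) = ((r : ℂ) • θ f) y := by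
    rw [hΦ, hθ, linearCombination_cocycle_mapDomain hc hf0, ← map_smul, inner_single_prod_left]
    exact congrArg ((r : ℂ) • Finsupp.linearCombination ℂ (fun x => c x⁻¹) f)
      (mul_inv_cancel_left (t : G) y)
  have hright (t : F) : inner ℂ (WithLp.toLp 2
      ((0 : lp (fun _ : G => ℂ) 2), lp.single (E := fun _ : G => ℂ) 2 (t : G) (1 : ℂ)))
      (Φ (h.mapDomain (· * (t : G)))) = ι h 1 := by
    rw [hΦ, hι, linearCombination_single_mapDomain, inner_single_prod_right]
    exact congrArg (Finsupp.linearCombination ℂ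
      (fun x : G => lp.single (E := fun _ : G => ℂ) 2 x (1 : ℂ)) h) (mul_inv_cancel (t : G))
  simp only [p, Fintype.sum_sum_type, Sum.elim_inl, Sum.elim_inr, inner_smul_right, hleft, hright,
    Finset.sum_const, Finset.card_univ, Fintype.card_coe, nsmul_eq_mul, norm_mul, hε2] at hbound
  have hFpos : (0 : ℝ) < F.card := by exact_mod_cast hF.card_pos
  have hrank' := hbound.trans ((Nat.cast_le.2 hrank).trans hcard)
  have hmain : ‖((r : ℂ) • θ f) y‖ ^ 2 + ((1 + 2 * ε)⁻¹ * ‖ι h 1‖) ^ 2 ≤ 1 + ε := by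
    refine le_of_mul_le_mul_left ?_ hFpos
    linarith
  have hlow₁ : (‖w y‖ - ε) ^ 2 ≤ ‖((r : ℂ) • θ f) y‖ ^ 2 := by
    have : 0 ≤ ‖w y‖ - ε := by rw [hε]; nlinarith
    gcongr
  have hlow₂ : 1 - 3 * ε ≤ (1 + 2 * ε)⁻¹ * ‖ι h 1‖ := by
    rw [← div_eq_inv_mul, le_div_iff₀ (by positivity)]
    nlinarith
  have hlow₃ : (1 - 3 * ε) ^ 2 ≤ ((1 + 2 * ε)⁻¹ * ‖ι h 1‖) ^ 2 := by
    have : 0 ≤ 1 - 3 * ε := by linarith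
    gcongr
  have hκε : ‖w y‖ ^ 2 = 20 * ε := by rw [hε]; ring
  nlinarith [mul_le_mul_of_nonneg_right hκ2 hε0.le]

/-- The functions `a` for which `x ↦ ⟪c x⁻¹, a⟫` is, up to an additive constant, in `ℓ²` are dense
in `ℓ²` of an infinite amenable group. -/
theorem dense_setOf_inner_cocycle {G : Type*} [Group G] [DecidableEq G] [Infinite G]
    (m : InvariantMean G)
    {c : G → lp (fun _ : G => ℂ) 2} (hc : ∀ g h : G, c (g * h) = lreg g (c h) + c g) :
    Dense {a : lp (fun _ : G => ℂ) 2 | ∃ b : lp (fun _ : G => ℂ) 2,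
      ∀ x y : G, inner ℂ (c x⁻¹ - c y⁻¹) a = b x - b y} := by
  let Φ := (WithLp.linearEquiv 2 ℂ
    (lp (fun _ : G => ℂ) 2 × lp (fun _ : G => ℂ) 2)).symm.toLinearMap ∘ₗ
      LinearMap.prod (Finsupp.linearCombination ℂ (fun x => c x⁻¹))
        (Finsupp.linearCombination ℂ
          (fun x : G => lp.single (E := fun _ : G => ℂ) 2 x (1 : ℂ)))
  have hΦ (f : G →₀ ℂ) : Φ f = WithLp.toLp 2 (Finsupp.linearCombination ℂ (fun x => c x⁻¹) f,
    Finsupp.linearCombination ℂ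
      (fun x : G => lp.single (E := fun _ : G => ℂ) 2 x (1 : ℂ)) f) := rfl
  let B := (LinearMap.ker (Finsupp.linearCombination ℂ (fun _ : G => (1 : ℂ)))).map Φ
  let A := Bᗮ.map (WithLp.fstₗ 2 ℂ (lp (fun _ : G => ℂ) 2) (lp (fun _ : G => ℂ) 2))
  have hAB : (A : Set (lp (fun _ : G => ℂ) 2)) ⊆ {a | ∃ b : lp (fun _ : G => ℂ) 2,
      ∀ x y : G, inner ℂ (c x⁻¹ - c y⁻¹) a = b x - b y} := by
    rintro _ ⟨z, hz, rfl⟩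
    refine ⟨-z.snd, fun x y => ?_⟩
    have hmem : Φ (Finsupp.single x 1 - Finsupp.single y 1) ∈ B :=
      Submodule.mem_map_of_mem (by simp)
    have h0 := (Submodule.mem_orthogonal _ _).1 hz _ hmem
    rw [hΦ, WithLp.prod_inner_apply] at h0
    simp only [map_sub, Finsupp.linearCombination_single, one_smul, inner_sub_left,
      lp.inner_single_left] at h0 ⊢
    simp at h0 ⊢
    linear_combination h0
  refine Dense.mono hAB ?_
  rw [Submodule.dense_iff_topologicalClosure_eq_top, Submodule.topologicalClosure_eq_top_iff,
    Submodule.eq_bot_iff]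
  intro w₀ hw₀
  obtain ⟨w, hw⟩ : ∃ w, w = ((2 * (‖w₀‖ + 1) : ℝ) : ℂ)⁻¹ • w₀ := ⟨_, rfl⟩
  have hwA : w ∈ Aᗮ := hw ▸ Submodule.smul_mem _ _ hw₀
  have hwnorm : ‖w‖ ≤ 1 / 2 := by
    rw [hw, norm_smul, norm_inv, Complex.norm_real, Real.norm_of_nonneg (by positivity),
      inv_mul_le_iff₀ (by positivity)]
    linarith
  have hwB : WithLp.toLp 2 (w, (0 : lp (fun _ : G => ℂ) 2)) ∈ Bᗮᗮ := by
    refine (Submodule.mem_orthogonal _ _).2 fun z hz => ?_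
    have := (Submodule.mem_orthogonal _ _).1 hwA _ (Submodule.mem_map_of_mem hz)
    rw [WithLp.prod_inner_apply]
    simpa using this
  rw [Submodule.orthogonal_orthogonal_eq_closure, ← SetLike.mem_coe,
    Submodule.topologicalClosure_coe] at hwB
  have hw0 : w = 0 := by
    ext y
    refine apply_eq_zero_of_approx (fun Ω ε hε => m.exists_card_mul_le Ω hε) hc hwnorm
      (fun ε hε => ?_) y
    obtain ⟨_, ⟨f, hf, rfl⟩, hfw⟩ := Metric.mem_closure_iff.1 hwB ε hε
    rw [dist_comm, dist_eq_norm, hΦ, ← WithLp.toLp_sub] at hfw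
    refine ⟨f, hf, (WithLp.norm_fst_le _ _).trans hfw.le, ?_⟩
    refine le_trans ?_ ((WithLp.norm_snd_le _ _).trans hfw.le)
    simp
  have hne : ((2 * (‖w₀‖ + 1) : ℝ) : ℂ)⁻¹ ≠ 0 :=
    inv_ne_zero (by exact_mod_cast (by positivity : (2 * (‖w₀‖ + 1) : ℝ) ≠ 0))
  exact (smul_eq_zero.1 (hw ▸ hw0)).resolve_left hne

/-- On a countable discrete amenable group, every `1`-cocycle with values in `ℓ²G`
is either bounded or proper. -/
theorem amenable_cocycle_bounded_or_proper {G : Type*} [Group G] [Countable G]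
    (hamen : Nonempty (InvariantMean G))
    (c : G → lp (fun _ : G => ℂ) 2)
    (hc : ∀ g h : G, c (g * h) = lreg g (c h) + c g) :
    (∃ C : ℝ, 0 ≤ C ∧ ∀ g : G, ‖c g‖ ≤ C) ∨
      ∀ C : ℝ, 0 ≤ C → {g : G | ‖c g‖ ≤ C}.Finite := by
  classical
  refine or_iff_not_imp_right.2 fun hproper => ?_
  push Not at hproper
  obtain ⟨C, hC, hinf⟩ := hproper
  have : Infinite G := Set.infinite_univ_iff.1 (hinf.mono (Set.subset_univ _))
  obtain ⟨m⟩ := hamen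
  refine ⟨2 * C, by positivity, fun g => ?_⟩
  have hinner (a : lp (fun _ : G => ℂ) 2) : ‖inner ℂ (c g) a‖ ≤ 2 * C * ‖a‖ := by
    refine (dense_setOf_inner_cocycle m hc).induction ?_
      (isClosed_le (by fun_prop) (by fun_prop)) a
    rintro a ⟨b, hb⟩
    have hbound (x : G) : ‖b x‖ ≤ C * ‖a‖ := by
      refine le_of_forall_pos_le_add fun δ hδ => ?_
      have hsmall : {g : G | δ ≤ ‖b (g⁻¹ * x)‖}.Finite :=
        (lp.finite_le_norm b hδ).preimage (f := fun g : G => g⁻¹ * x)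
          (Function.Injective.injOn fun g h hgh => inv_injective (mul_right_cancel hgh))
      obtain ⟨k, hkC, hkδ⟩ := (hinf.sdiff hsmall).nonempty
      simp only [Set.mem_ofPred_eq, not_le] at hkC hkδ
      have hk : c (k⁻¹ * x)⁻¹ - c x⁻¹ = lreindex (Equiv.mulLeft x⁻¹⁻¹) (c k) := by
        rw [mul_inv_rev, inv_inv, hc, lreindex_mulLeft_inv, add_sub_cancel_right]
      have h1 : ‖b (k⁻¹ * x) - b x‖ ≤ C * ‖a‖ := by
        rw [← hb, hk]
        refine (norm_inner_le_norm _ _).trans ?_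
        rw [LinearIsometry.norm_map]
        gcongr
      have h2 := norm_sub_le (b (k⁻¹ * x)) (b (k⁻¹ * x) - b x)
      rw [sub_sub_cancel] at h2
      linarith
    have hc1 : c 1 = 0 := by
      have h1 := hc 1 1
      rw [mul_one, ← lreindex_mulLeft_inv] at h1
      have h2 : lreindex (Equiv.mulLeft (1 : G)⁻¹) (c 1) = 0 := by
        simpa using h1
      rwa [← norm_eq_zero, LinearIsometry.norm_map, norm_eq_zero] at h2
    have hg := hb g⁻¹ 1
    rw [inv_inv, inv_one, hc1, sub_zero] at hg
    rw [hg]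
    refine (norm_sub_le _ _).trans ?_
    linarith [hbound g⁻¹, hbound 1]
  rcases (norm_nonneg (c g)).eq_or_lt with h0 | h0
  · rw [← h0]
    positivity
  · have := hinner (c g)
    rw [inner_self_eq_norm_sq_to_K, norm_pow, RCLike.norm_ofReal, abs_norm] at this
    exact le_of_mul_le_mul_right (by nlinarith) h0
end

section
/- Let G = H₁ ∗ H₂ be the free product of two nontrivial countable discrete groups H₁ and H₂, and assume H₁ is not isomorphic to ℤ/2ℤ. Then there exists a 1-cocycle c : G → ℓ²G (for the left regular representation) which is neither bounded nor proper, i.e., the set of norms {‖c(g)‖ : g ∈ G} is unbounded, and there exists C ≥ 0 such that {g ∈ G : ‖c(g)‖ ≤ C} is infinite. -/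
open scoped ENNReal

namespace Monoid.CoprodI.Word

section Weight

variable {ι : Type*} {M : ι → Type*} [∀ i, Monoid (M i)] {R : Type*} [CommMonoid R]

/-- The multiplicative function on reduced words that sends every letter from `M i` to `c i`. -/
def weight (c : ι → R) (w : Word M) : R :=
  (w.toList.map fun l => c l.1).prod

@[simp]
theorem weight_empty (c : ι → R) : weight c (empty : Word M) = 1 := by
  simp [weight, empty]

@[simp]
theorem weight_cons (c : ι → R) {i : ι} (m : M i) (w : Word M) (hw : w.fstIdx ≠ some i)
    (hm : m ≠ 1) : weight c (cons m w hw hm) = c i * weight c w := by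
  simp [weight]

theorem map_weight {S : Type*} [CommMonoid S] (f : R →* S) (c : ι → R) (w : Word M) :
    f (weight c w) = weight (fun i => f (c i)) w := by
  simp [weight, map_list_prod, Function.comp_def]

end Weight

/-- If the values of `c` satisfy `1 + (|H i| - 1) c i = 0`, then `weight c` sums to zero over every
coset of the factor `H i`. -/
theorem sum_weight_of_smul {ι : Type*} {H : ι → Type*} [∀ i, Group (H i)] [DecidableEq ι]
    [∀ i, DecidableEq (H i)] {R : Type*} [CommRing R] (c : ι → R) (i : ι) [Fintype (H i)]
    (hc : 1 + ((Fintype.card (H i) : R) - 1) * c i = 0) (w : Word H) :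
    ∑ h : H i, weight c ((of h : CoprodI H) • w) = 0 := by
  have key (h : H i) : weight c ((of h : CoprodI H) • w) =
      (if h * (equivPair i w).head = 1 then 1 else c i) * weight c (equivPair i w).tail := by
    rw [of_smul_def, rcons]
    split_ifs <;> simp
  have h1 : ∑ h : H i, (if h * (equivPair i w).head = 1 then 1 else c i) =
      ∑ h : H i, (c i + if h = 1 then 1 - c i else 0) := by
    rw [← Equiv.sum_comp (Equiv.mulRight (equivPair i w).head)
      (fun h : H i => c i + if h = 1 then 1 - c i else 0)]
    refine Finset.sum_congr rfl fun h _ => ?_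
    change _ = c i + if h * (equivPair i w).head = 1 then 1 - c i else 0
    split_ifs <;> simp
  rw [Finset.sum_congr rfl fun h _ => key h, ← Finset.sum_mul, h1, Finset.sum_add_distrib]
  simp only [Finset.sum_const, Finset.card_univ, nsmul_eq_mul, Finset.sum_ite_eq',
    Finset.mem_univ, if_true]
  linear_combination weight c (equivPair i w).tail * hc

section Summable

variable {H : Bool → Type*} [∀ i, Group (H i)]

/-- The reduced words of length at most `n` that do not start with a letter from `H i`. -/
def shortWords (H : Bool → Type*) [∀ i, Group (H i)] (i : Bool) (n : ℕ) : Set (Word H) :=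
  {w | w.toList.length ≤ n ∧ w.fstIdx ≠ some i}

theorem shortWords_zero (i : Bool) : shortWords H i 0 ⊆ {empty} := by
  rintro w ⟨hw, -⟩
  exact Word.ext (by simpa using hw)

theorem shortWords_succ_subset (i : Bool) (n : ℕ) :
    shortWords H i (n + 1) ⊆ {empty} ∪ ⋃ h : {h : H (!i) // h ≠ 1},
      Set.range fun w : shortWords H (!i) n => cons h.1 w.1 w.2.2 h.2 := by
  rintro w ⟨hw, hi⟩
  induction w using consRecOn with
  | empty => exact Or.inl rfl
  | cons j m w h1 h2 _ =>
    have hj : j = !i := by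
      cases i <;> cases j <;> simp_all [fstIdx, cons]
    subst hj
    exact Or.inr (Set.mem_iUnion.2 ⟨⟨m, h2⟩, ⟨w, by simpa using hw, h1⟩, rfl⟩)

theorem tsum_shortWords_succ_le [∀ i, Fintype (H i)] (d : Bool → ℝ≥0∞) (i : Bool) (n : ℕ) :
    ∑' w : shortWords H i (n + 1), weight d w.1 ≤
      1 + ((Fintype.card (H (!i)) - 1 : ℕ) * d (!i)) *
        ∑' w : shortWords H (!i) n, weight d w.1 := by
  classical
  refine (ENNReal.tsum_mono_subtype _ (shortWords_succ_subset i n)).trans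
    ((ENNReal.tsum_union_le _ _ _).trans (add_le_add (by simp) ?_))
  refine (ENNReal.tsum_iUnion_le _ _).trans ?_
  have hle (h : {h : H (!i) // h ≠ 1}) :
      ∑' w : Set.range fun w : shortWords H (!i) n => cons h.1 w.1 w.2.2 h.2, weight d w.1 ≤
        d (!i) * ∑' w : shortWords H (!i) n, weight d w.1 := by
    refine (ENNReal.tsum_le_tsum_comp_of_surjective Set.rangeFactorization_surjective _).trans ?_
    simp [Set.rangeFactorization, ENNReal.tsum_mul_left]
  refine (Finset.sum_le_sum fun h _ => hle h).trans ?_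
  simp [Fintype.card_subtype_compl, mul_assoc]

theorem tsum_shortWords_le [∀ i, Fintype (H i)] (d : Bool → ℝ≥0∞)
    (h₁ : (Fintype.card (H true) - 1 : ℕ) * d true ≤ 2⁻¹)
    (h₂ : (Fintype.card (H false) - 1 : ℕ) * d false ≤ 1) (n : ℕ) :
    ∑' w : shortWords H true n, weight d w.1 ≤ 4 ∧
      ∑' w : shortWords H false n, weight d w.1 ≤ 3 := by
  have h0 (i : Bool) : ∑' w : shortWords H i 0, weight d w.1 ≤ 1 :=
    (ENNReal.tsum_mono_subtype _ (shortWords_zero i)).trans (by simp)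
  induction n with
  | zero => exact ⟨(h0 _).trans (by norm_num), (h0 _).trans (by norm_num)⟩
  | succ n ih =>
    refine ⟨(tsum_shortWords_succ_le d true n).trans ?_,
      (tsum_shortWords_succ_le d false n).trans ?_⟩
    · calc _ ≤ 1 + 1 * (3 : ℝ≥0∞) := by gcongr; exacts [h₂, ih.2]
        _ = 4 := by norm_num
    · calc _ ≤ 1 + 2⁻¹ * (4 : ℝ≥0∞) := by gcongr; exacts [h₁, ih.1]
        _ = 1 + 2⁻¹ * 2 * 2 := by rw [mul_assoc]; norm_num
        _ = 3 := by rw [ENNReal.inv_mul_cancel (by norm_num) (by norm_num)]; norm_num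

theorem tsum_weight_ne_top [∀ i, Fintype (H i)] (d : Bool → ℝ≥0∞)
    (h₁ : (Fintype.card (H true) - 1 : ℕ) * d true ≤ 2⁻¹)
    (h₂ : (Fintype.card (H false) - 1 : ℕ) * d false ≤ 1) :
    ∑' w : Word H, weight d w ≠ ∞ := by
  refine ne_top_of_le_ne_top (b := 4 + 3) (by norm_num) ?_
  rw [ENNReal.tsum_eq_iSup_sum]
  refine iSup_le fun s => ?_
  set n := s.sup fun w => w.toList.length
  have hs : (s : Set (Word H)) ⊆ shortWords H true n ∪ shortWords H false n := by
    intro w hw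
    have hn : w.toList.length ≤ n := Finset.le_sup (f := fun w : Word H => w.toList.length) hw
    by_cases h : w.fstIdx = some true
    · exact Or.inr ⟨hn, by simp [h]⟩
    · exact Or.inl ⟨hn, h⟩
  rw [← Finset.tsum_subtype]
  exact (ENNReal.tsum_mono_subtype _ hs).trans ((ENNReal.tsum_union_le _ _ _).trans
    (add_le_add (tsum_shortWords_le d h₁ h₂ n).1 (tsum_shortWords_le d h₁ h₂ n).2))

end Summable

end Monoid.CoprodI.Word

theorem Monoid.CoprodI.pow_of_mul_of_ne_one {ι : Type*} {M : ι → Type*} [∀ i, Monoid (M i)]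
    {i j : ι} (hij : i ≠ j) {a : M i} {b : M j} (ha : a ≠ 1) (hb : b ≠ 1) (n : ℕ) :
    (of a * of b : CoprodI M) ^ (n + 1) ≠ 1 := by
  classical
  have key : ∃ w : NeWord M i j, w.prod = (of a * of b : CoprodI M) ^ (n + 1) := by
    induction n with
    | zero => exact ⟨.append (.singleton a ha) hij (.singleton b hb), by simp⟩
    | succ n ih =>
      obtain ⟨w, hw⟩ := ih
      exact ⟨.append w hij.symm (.append (.singleton a ha) hij (.singleton b hb)), by
        simp [hw, pow_succ]⟩
  obtain ⟨w, hw⟩ := key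
  rw [← hw]
  intro h
  have h' : w.toWord = Word.empty := Word.equiv.symm.injective (h.trans Word.prod_empty.symm)
  exact w.toList_ne_nil (congrArg Word.toList h')

namespace Monoid.Coprod

universe u v

/-- The two factors of a free product as a family indexed by `Bool`. -/
def Factor (H₁ : Type u) (H₂ : Type v) : Bool → Type (max u v)
  | true => ULift.{v} H₁
  | false => ULift.{u} H₂

variable {H₁ : Type u} {H₂ : Type v} [Group H₁] [Group H₂]

instance : ∀ i, Group (Factor H₁ H₂ i)
  | true => inferInstanceAs (Group (ULift H₁))
  | false => inferInstanceAs (Group (ULift H₂))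

/-- The first factor as a member of the family `Factor`. -/
def factorTrue : H₁ ≃* Factor H₁ H₂ true := (MulEquiv.ulift (α := H₁)).symm

/-- The second factor as a member of the family `Factor`. -/
def factorFalse : H₂ ≃* Factor H₁ H₂ false := (MulEquiv.ulift (α := H₂)).symm

/-- The canonical map from the binary free product to the free product of a family. -/
def toCoprodI : Coprod H₁ H₂ →* CoprodI (Factor H₁ H₂) :=
  lift (CoprodI.of.comp factorTrue.toMonoidHom) (CoprodI.of.comp factorFalse.toMonoidHom)

theorem toCoprodI_inl (h : H₁) :
    toCoprodI (inl h : Coprod H₁ H₂) = CoprodI.of (factorTrue h) := rfl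

theorem toCoprodI_inr (h : H₂) :
    toCoprodI (inr h : Coprod H₁ H₂) = CoprodI.of (factorFalse h) := rfl

theorem toCoprodI_injective :
    Function.Injective (toCoprodI : Coprod H₁ H₂ →* CoprodI (Factor H₁ H₂)) := by
  let g : ∀ i, Factor H₁ H₂ i →* Coprod H₁ H₂ := fun i => match i with
    | true => inl.comp factorTrue.symm.toMonoidHom
    | false => inr.comp factorFalse.symm.toMonoidHom
  have h : (CoprodI.lift g).comp toCoprodI = .id (Coprod H₁ H₂) := by
    refine hom_ext (MonoidHom.ext fun x => ?_) (MonoidHom.ext fun x => ?_)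
    · simp [toCoprodI_inl, g]
    · simp [toCoprodI_inr, g]
  exact Function.LeftInverse.injective (g := CoprodI.lift g) (DFunLike.congr_fun h)

theorem pow_inl_mul_inr_injective {a : H₁} {b : H₂} (ha : a ≠ 1) (hb : b ≠ 1) :
    Function.Injective fun n : ℕ => (inl a * inr b : Coprod H₁ H₂) ^ n := by
  rw [injective_pow_iff_not_isOfFinOrder, isOfFinOrder_iff_pow_eq_one]
  rintro ⟨n, hn, h⟩
  obtain ⟨n, rfl⟩ := Nat.exists_eq_succ_of_ne_zero hn.ne'
  refine CoprodI.pow_of_mul_of_ne_one (M := Factor H₁ H₂) (i := true) (j := false) (by simp)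
    (a := factorTrue a) (b := factorFalse b) (by simpa using ha) (by simpa using hb) n ?_
  rw [← toCoprodI_inl, ← toCoprodI_inr, ← map_mul, ← map_pow, h, map_one]

theorem exists_harmonic [Fintype H₁] [Fintype H₂] (h₁ : 3 ≤ Fintype.card H₁)
    (h₂ : 2 ≤ Fintype.card H₂) :
    ∃ u : lp (fun _ : Coprod H₁ H₂ => ℂ) 2, u ≠ 0 ∧
      ∑ h : H₁, lreg (inl h) u = 0 ∧ ∑ h : H₂, lreg (inr h) u = 0 := by
  classical
  let fF : ∀ i, Fintype (Factor H₁ H₂ i) := fun i => match i with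
    | true => Fintype.ofEquiv H₁ factorTrue.toEquiv
    | false => Fintype.ofEquiv H₂ factorFalse.toEquiv
  have hc₁ : Fintype.card (Factor H₁ H₂ true) = Fintype.card H₁ :=
    Fintype.card_congr factorTrue.toEquiv.symm
  have hc₂ : Fintype.card (Factor H₁ H₂ false) = Fintype.card H₂ :=
    Fintype.card_congr factorFalse.toEquiv.symm
  let c (i : Bool) : ℂ := -((Fintype.card (Factor H₁ H₂ i) - 1 : ℕ) : ℂ)⁻¹
  let F : Coprod H₁ H₂ → ℂ := fun g =>
    CoprodI.Word.weight c (toCoprodI g • (CoprodI.Word.empty : CoprodI.Word (Factor H₁ H₂)))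
  have hcard (i : Bool) : 2 ≤ Fintype.card (Factor H₁ H₂ i) := by
    cases i
    · exact hc₂ ▸ h₂
    · exact hc₁ ▸ (by lia : 2 ≤ Fintype.card H₁)
  have hc (i : Bool) : 1 + ((Fintype.card (Factor H₁ H₂ i) : ℂ) - 1) * c i = 0 := by
    have h := hcard i
    have h' : ((Fintype.card (Factor H₁ H₂ i) - 1 : ℕ) : ℂ) ≠ 0 := by
      exact_mod_cast (by lia : Fintype.card (Factor H₁ H₂ i) - 1 ≠ 0)
    have h'' : (Fintype.card (Factor H₁ H₂ i) : ℂ) - 1 =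
        ((Fintype.card (Factor H₁ H₂ i) - 1 : ℕ) : ℂ) := by
      rw [Nat.cast_sub (by lia), Nat.cast_one]
    simp only [c, h'', mul_neg, mul_inv_cancel₀ h', add_neg_cancel]
  let N : ℂ →* ℝ≥0∞ :=
    { toFun := fun z => ‖z‖ₑ ^ 2
      map_one' := by simp
      map_mul' := fun x y => by simp [mul_pow] }
  have hd (i : Bool) : ((Fintype.card (Factor H₁ H₂ i) - 1 : ℕ) : ℝ≥0∞) * N (c i) =
      ((Fintype.card (Factor H₁ H₂ i) - 1 : ℕ) : ℝ≥0∞)⁻¹ := by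
    have h := hcard i
    have h' : Fintype.card (Factor H₁ H₂ i) - 1 ≠ 0 := by lia
    have h3 : ‖c i‖ₑ = ((Fintype.card (Factor H₁ H₂ i) - 1 : ℕ) : ℝ≥0∞)⁻¹ := by
      simp only [c, enorm_neg]
      rw [enorm_inv (by exact_mod_cast h')]
      simp [enorm_eq_nnnorm]
    change _ * ‖c i‖ₑ ^ 2 = _
    rw [h3, sq, ← mul_assoc, ENNReal.mul_inv_cancel (by exact_mod_cast h') (by simp), one_mul]
  have hsum : ∑' w : CoprodI.Word (Factor H₁ H₂), N (CoprodI.Word.weight c w) ≠ ∞ := by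
    simp_rw [CoprodI.Word.map_weight]
    refine CoprodI.Word.tsum_weight_ne_top _ ?_ ?_
    · rw [hd, ENNReal.inv_le_inv, hc₁]
      exact_mod_cast (by lia : 2 ≤ Fintype.card H₁ - 1)
    · rw [hd, ENNReal.inv_le_one, hc₂]
      exact_mod_cast (by lia : 1 ≤ Fintype.card H₂ - 1)
  have hF : Memℓp F 2 := by
    refine memℓp_gen ?_
    have h := (ENNReal.summable_toReal hsum).comp_injective
      (CoprodI.Word.equiv.injective.comp (toCoprodI_injective (H₁ := H₁) (H₂ := H₂)))
    refine h.congr fun g => ?_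
    simp [N, F, CoprodI.Word.equiv]
  have harm (i : Bool) (g : Coprod H₁ H₂) : ∑ h : Factor H₁ H₂ i,
      CoprodI.Word.weight c ((CoprodI.of h * toCoprodI g) •
        (CoprodI.Word.empty : CoprodI.Word (Factor H₁ H₂))) = 0 := by
    simp_rw [mul_smul]
    exact CoprodI.Word.sum_weight_of_smul c i (hc i) _
  refine ⟨⟨F, hF⟩, fun h => ?_, ?_, ?_⟩
  · have h1 : F 1 = 0 := congrFun (congrArg Subtype.val h) 1
    simp [F] at h1
  · refine lp.ext (funext fun g => ?_)
    rw [lp.coeFn_sum, Finset.sum_apply]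
    change ∑ h : H₁, F ((inl h)⁻¹ * g) = 0
    rw [← harm true g, ← Equiv.sum_comp ((Equiv.inv H₁).trans factorTrue.toEquiv)]
    simp [F, toCoprodI_inl]
  · refine lp.ext (funext fun g => ?_)
    rw [lp.coeFn_sum, Finset.sum_apply]
    change ∑ h : H₂, F ((inr h)⁻¹ * g) = 0
    rw [← harm false g, ← Equiv.sum_comp ((Equiv.inv H₂).trans factorFalse.toEquiv)]
    simp [F, toCoprodI_inr]

end Monoid.Coprod

theorem lp_tendsto_apply_cofinite {ι : Type*} (f : lp (fun _ : ι => ℂ) 2) :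
    Filter.Tendsto (fun x => f x) Filter.cofinite (nhds 0) := by
  have h := ((memℓp_gen_iff (by norm_num)).1 (lp.memℓp f)).tendsto_cofinite_zero
  have h' := h.rpow_const (p := 2⁻¹) (Or.inr (by norm_num))
  rw [tendsto_zero_iff_norm_tendsto_zero]
  convert h' using 2
  · rw [← Real.rpow_mul (norm_nonneg _)]
    norm_num
  · norm_num

section Regular

variable {G : Type*} [Group G]

@[simp]
theorem lreg_apply (g : G) (f : lp (fun _ : G => ℂ) 2) (x : G) : lreg g f x = f (g⁻¹ * x) := rfl

/-- The left regular representation as a homomorphism to linear endomorphisms. -/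
noncomputable def lregHom (G : Type*) [Group G] : G →* Module.End ℂ (lp (fun _ : G => ℂ) 2) where
  toFun g :=
    { toFun := lreg g
      map_add' := fun _ _ => rfl
      map_smul' := fun _ _ => rfl }
  map_one' := LinearMap.ext fun f => lp.ext <| funext fun x => by
    change f (1⁻¹ * x) = f x
    simp
  map_mul' g h := LinearMap.ext fun f => lp.ext <| funext fun x => by
    change f ((g * h)⁻¹ * x) = f (h⁻¹ * (g⁻¹ * x))
    rw [mul_inv_rev, mul_assoc]

@[simp]
theorem lregHom_apply (g : G) (f : lp (fun _ : G => ℂ) 2) : lregHom G g f = lreg g f := rfl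

theorem norm_lreg (g : G) (f : lp (fun _ : G => ℂ) 2) : ‖lreg g f‖ = ‖f‖ := by
  rw [lp.norm_eq_tsum_rpow (by norm_num), lp.norm_eq_tsum_rpow (by norm_num)]
  congr 1
  exact (Equiv.mulLeft g⁻¹).tsum_eq fun x => ‖f x‖ ^ (2 : ℝ≥0∞).toReal

/-- The left regular representation is mixing. -/
theorem tendsto_inner_lreg (v w : lp (fun _ : G => ℂ) 2) :
    Filter.Tendsto (fun g => inner ℂ w (lreg g v)) Filter.cofinite (nhds 0) := by
  classical
  have hsingle (i : G) (z : ℂ) : Filter.Tendsto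
      (fun g => inner ℂ (lp.single 2 i z : lp (fun _ : G => ℂ) 2) (lreg g v))
      Filter.cofinite (nhds 0) := by
    have hinj : Function.Injective fun g : G => g⁻¹ * i :=
      (mul_left_injective i).comp inv_injective
    have h := ((lp_tendsto_apply_cofinite v).comp hinj.tendsto_cofinite).mul_const (star z)
    simpa [lp.inner_single_left] using h
  have hfin (s : Finset G) : Filter.Tendsto
      (fun g => inner ℂ (∑ i ∈ s, lp.single 2 i (w i) : lp (fun _ : G => ℂ) 2) (lreg g v))
      Filter.cofinite (nhds 0) := by
    simp_rw [sum_inner]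
    simpa using tendsto_finsetSum s fun i _ => hsingle i (w i)
  rw [Metric.tendsto_nhds]
  intro ε hε
  have hw : HasSum (fun i => (lp.single 2 i (w i) : lp (fun _ : G => ℂ) 2)) w :=
    lp.hasSum_single ENNReal.ofNat_ne_top w
  have hpos : 0 < ε / 2 / (‖v‖ + 1) := by positivity
  obtain ⟨s, hs⟩ := (Metric.tendsto_nhds.1 hw _ hpos).exists
  filter_upwards [Metric.tendsto_nhds.1 (hfin s) (ε / 2) (by positivity)] with g hg
  rw [dist_zero_right] at hg ⊢
  set p := ∑ i ∈ s, (lp.single 2 i (w i) : lp (fun _ : G => ℂ) 2)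
  have h1 : ‖inner ℂ (w - p) (lreg g v)‖ ≤ ε / 2 := by
    refine (norm_inner_le_norm _ _).trans ?_
    rw [norm_lreg, ← dist_eq_norm, dist_comm]
    calc _ ≤ ε / 2 / (‖v‖ + 1) * (‖v‖ + 1) := by gcongr; linarith
      _ = ε / 2 := by field_simp
  calc ‖inner ℂ w (lreg g v)‖ = ‖inner ℂ (w - p) (lreg g v) + inner ℂ p (lreg g v)‖ := by
        rw [← inner_add_left, sub_add_cancel]
    _ ≤ _ := norm_add_le _ _
    _ < ε := by linarith

/-- A bounded cocycle of the regular representation with infinitely many zeros vanishes. -/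
theorem cocycle_eq_zero_of_bounded {c : G → lp (fun _ : G => ℂ) 2}
    (hc : ∀ g h, c (g * h) = lreg g (c h) + c g) (hz : {g | c g = 0}.Infinite)
    {C : ℝ} (hC : ∀ g, ‖c g‖ ≤ C) (g : G) : c g = 0 := by
  have hstep {D : ℝ} (hD : ∀ g, ‖c g‖ ^ 2 ≤ D) (g : G) : ‖c g‖ ^ 2 ≤ D / 2 := by
    have hinj : Function.Injective fun s : {s | c s = 0} => g * s.1 :=
      (mul_right_injective g).comp Subtype.val_injective
    have : Infinite {s | c s = 0} := hz.to_subtype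
    have hlim := (tendsto_inner_lreg (c g) (c g)).comp hinj.tendsto_cofinite
    have hlim' := ((Complex.continuous_re.tendsto 0).comp hlim).const_mul 2
    have hle : 2 * (0 : ℂ).re ≤ D - 2 * ‖c g‖ ^ 2 := by
      refine le_of_tendsto' hlim' fun s => ?_
      have h := hD (g * s.1 * g)
      rw [hc, hc g, s.2, add_comm, @norm_add_sq ℂ, norm_lreg] at h
      have h0 : lreg g (0 : lp (fun _ : G => ℂ) 2) = 0 := map_zero (lregHom G g)
      rw [h0, zero_add] at h
      simp only [Function.comp_apply]
      change _ + 2 * (inner ℂ (c g) (lreg (g * s.1) (c g))).re + _ ≤ D at h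
      linarith
    simp only [Complex.zero_re] at hle
    linarith
  have hpow (n : ℕ) : ∀ g, ‖c g‖ ^ 2 ≤ C ^ 2 / 2 ^ n := by
    induction n with
    | zero => exact fun g => by simpa using pow_le_pow_left₀ (norm_nonneg _) (hC g) 2
    | succ n ih => exact fun g => (hstep ih g).trans_eq (by rw [pow_succ]; ring)
  have hlim : Filter.Tendsto (fun n : ℕ => C ^ 2 / 2 ^ n) Filter.atTop (nhds 0) := by
    have h := (tendsto_pow_atTop_nhds_zero_of_lt_one (r := (2 : ℝ)⁻¹) (by norm_num)
      (by norm_num)).const_mul (C ^ 2)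
    simpa [div_eq_mul_inv] using h
  have h0 : ‖c g‖ ^ 2 ≤ 0 := ge_of_tendsto' hlim fun n => hpow n g
  simpa using le_antisymm h0 (by positivity)

theorem unbounded_and_not_proper_of_cocycle {c : G → lp (fun _ : G => ℂ) 2}
    (hc : ∀ g h, c (g * h) = lreg g (c h) + c g) (hz : {g | c g = 0}.Infinite)
    {g₀ : G} (h₀ : c g₀ ≠ 0) :
    (¬ ∃ C : ℝ, ∀ g, ‖c g‖ ≤ C) ∧ ∃ C : ℝ, 0 ≤ C ∧ {g | ‖c g‖ ≤ C}.Infinite :=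
  ⟨fun ⟨_, hC⟩ => h₀ (cocycle_eq_zero_of_bounded hc hz hC g₀),
    0, le_rfl, hz.mono fun g (hg : c g = 0) => by simp [hg]⟩

/-- A proper finite subgroup of `H` is detected by a vector that it fixes and `H` does not. -/
theorem exists_lreg_fixed {H : Type*} [Group H] {φ : H →* G} (hφ : Function.Injective φ)
    {A : Subgroup H} (hfin : (A : Set H).Finite) (hA : A ≠ ⊤) :
    ∃ w : lp (fun _ : G => ℂ) 2, (∀ a ∈ A, lreg (φ a) w = w) ∧ ∃ h, lreg (φ h) w ≠ w := by
  classical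
  let S : Set G := φ '' A
  have hS : S.Finite := hfin.image φ
  have hmem : Memℓp (S.indicator fun _ => (1 : ℂ)) 2 := by
    refine memℓp_gen (summable_of_hasFiniteSupport (hS.subset fun x hx => ?_))
    by_contra h
    simp [Set.indicator_of_notMem h] at hx
  refine ⟨⟨_, hmem⟩, fun a ha => ?_, ?_⟩
  · ext x
    change S.indicator (fun _ => (1 : ℂ)) ((φ a)⁻¹ * x) = S.indicator (fun _ => (1 : ℂ)) x
    have hiff : (φ a)⁻¹ * x ∈ S ↔ x ∈ S := by
      constructor
      · rintro ⟨y, hy, hyx⟩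
        exact ⟨a * y, A.mul_mem ha hy, by rw [map_mul, hyx, mul_inv_cancel_left]⟩
      · rintro ⟨y, hy, rfl⟩
        exact ⟨a⁻¹ * y, A.mul_mem (A.inv_mem ha) hy, by rw [map_mul, map_inv]⟩
    simp only [Set.indicator_apply, hiff]
  · obtain ⟨h, hh⟩ : ∃ h, h ∉ A := by
      by_contra! hall
      exact hA (eq_top_iff.2 fun x _ => hall x)
    refine ⟨h, fun heq => ?_⟩
    have h1 : S.indicator (fun _ => (1 : ℂ)) ((φ h)⁻¹ * φ h) =
        S.indicator (fun _ => (1 : ℂ)) (φ h) := congrFun (congrArg Subtype.val heq) (φ h)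
    have hnot : φ h ∉ S := by
      rintro ⟨y, hy, hyx⟩
      exact hh (hφ hyx ▸ hy)
    have hone : (1 : G) ∈ S := ⟨1, A.one_mem, map_one φ⟩
    rw [inv_mul_cancel, Set.indicator_of_mem hone, Set.indicator_of_notMem hnot] at h1
    exact one_ne_zero h1

end Regular

/-- If `T ^ m = 1` then every vector annihilated by `1 + T + ⋯ + T ^ (m - 1)` is in the range of
`T - 1`. -/
theorem Module.End.exists_apply_sub_eq {V : Type*} [AddCommGroup V] [Module ℂ V]
    {T : Module.End ℂ V} {m : ℕ} (hm : m ≠ 0) (hT : T ^ m = 1) {v : V}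
    (hv : ∑ k ∈ Finset.range m, (T ^ k) v = 0) : ∃ f, T f - f = v := by
  have key (n : ℕ) : T (∑ k ∈ Finset.range n, (k : ℂ) • (T ^ k) v) -
      ∑ k ∈ Finset.range n, (k : ℂ) • (T ^ k) v =
        (n : ℂ) • (T ^ n) v - T (∑ k ∈ Finset.range n, (T ^ k) v) := by
    induction n with
    | zero => simp
    | succ n ih =>
      rw [Finset.sum_range_succ, Finset.sum_range_succ, map_add, map_add, add_sub_add_comm, ih,
        map_smul, ← Module.End.mul_apply, ← pow_succ', Nat.cast_succ, add_smul, one_smul]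
      abel
  refine ⟨(m : ℂ)⁻¹ • ∑ k ∈ Finset.range m, (k : ℂ) • (T ^ k) v, ?_⟩
  rw [map_smul, ← smul_sub, key, hv, hT, map_zero, sub_zero, Module.End.one_apply,
    inv_smul_smul₀ (by exact_mod_cast hm)]

theorem sum_eq_sum_range_of_zpowers_eq_top {H V : Type*} [Group H] [Fintype H] [AddCommMonoid V]
    {a : H} (ha : Subgroup.zpowers a = ⊤) (F : H → V) :
    ∑ h, F h = ∑ k ∈ Finset.range (orderOf a), F (a ^ k) := by
  classical
  rw [← IsCyclic.image_range_orderOf (fun x => ha ▸ Subgroup.mem_top x), Finset.sum_image]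
  exact fun i hi j hj h => pow_injOn_Iio_orderOf (by simpa using hi) (by simpa using hj) h

/-- A generator `a` of a finite group `H` mapping to `G` has `v` in the range of `a - 1` as soon as
the `H`-translates of `v` sum to zero. -/
theorem exists_lreg_sub_eq {G H : Type*} [Group G] [Group H] [Fintype H] (φ : H →* G) {a : H}
    (ha : Subgroup.zpowers a = ⊤) {v : lp (fun _ : G => ℂ) 2}
    (hv : ∑ h : H, lreg (φ h) v = 0) : ∃ f, lreg (φ a) f - f = v := by
  refine Module.End.exists_apply_sub_eq (T := lregHom G (φ a)) (orderOf_pos a).ne' ?_ ?_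
  · rw [← map_pow, ← map_pow, pow_orderOf_eq_one, map_one, map_one]
  · rw [sum_eq_sum_range_of_zpowers_eq_top ha] at hv
    simpa [← map_pow] using hv

/-- The affine action of `H` on `ℓ²G`, through `φ` and the left regular representation, with fixed
point `-w`. -/
noncomputable def affineHom {G H : Type*} [Group G] [Group H] (φ : H →* G)
    (w : lp (fun _ : G => ℂ) 2) : H →* Function.End (lp (fun _ : G => ℂ) 2) where
  toFun h := fun x => lregHom G (φ h) (x + w) - w
  map_one' := by
    funext x
    change lregHom G (φ 1) (x + w) - w = x
    rw [map_one, map_one, Module.End.one_apply, add_sub_cancel_right]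
  map_mul' h k := by
    funext x
    change lregHom G (φ (h * k)) (x + w) - w =
      lregHom G (φ h) (lregHom G (φ k) (x + w) - w + w) - w
    rw [sub_add_cancel, map_mul, map_mul, Module.End.mul_apply]

namespace Monoid.Coprod

variable {H₁ H₂ : Type*} [Group H₁] [Group H₂]

/-- Inner derivations on the two factors glue to a cocycle on the free product. -/
theorem exists_cocycle (w₁ w₂ : lp (fun _ : Coprod H₁ H₂ => ℂ) 2) :
    ∃ c : Coprod H₁ H₂ → lp (fun _ : Coprod H₁ H₂ => ℂ) 2,
      (∀ g h, c (g * h) = lreg g (c h) + c g) ∧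
      (∀ h, c (inl h) = lreg (inl h) w₁ - w₁) ∧ ∀ h, c (inr h) = lreg (inr h) w₂ - w₂ := by
  let L := lregHom (Coprod H₁ H₂)
  let α := lift (affineHom inl w₁) (affineHom inr w₂)
  have hmul (g h : Coprod H₁ H₂) (x) : α (g * h) x = α g (α h x) :=
    congrFun (map_mul α g h) x
  have hα (g : Coprod H₁ H₂) : ∀ x, α g x = L g x + α g 0 := by
    induction g using Coprod.induction_on with
    | inl h =>
      intro x
      change L (inl h) (x + w₁) - w₁ = L (inl h) x + (L (inl h) (0 + w₁) - w₁)
      rw [map_add, zero_add, add_sub_assoc]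
    | inr h =>
      intro x
      change L (inr h) (x + w₂) - w₂ = L (inr h) x + (L (inr h) (0 + w₂) - w₂)
      rw [map_add, zero_add, add_sub_assoc]
    | mul g h hg hh =>
      intro x
      rw [hmul, hg, hh x, hmul, hg (α h 0), map_add, map_mul, Module.End.mul_apply, add_assoc]
  refine ⟨fun g => α g 0, fun g h => ?_, fun h => ?_, fun h => ?_⟩
  · exact (hmul g h 0).trans (hα g _)
  · change L (inl h) (0 + w₁) - w₁ = _
    rw [zero_add]
    rfl
  · change L (inr h) (0 + w₂) - w₂ = _
    rw [zero_add]
    rfl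

theorem infinite_zeros_of_inl_mul_inr {c : Coprod H₁ H₂ → lp (fun _ : Coprod H₁ H₂ => ℂ) 2}
    (hc : ∀ g h, c (g * h) = lreg g (c h) + c g) {a : H₁} {b : H₂} (ha : a ≠ 1) (hb : b ≠ 1)
    (hab : c (inl a * inr b) = 0) : {g | c g = 0}.Infinite := by
  refine (Set.infinite_range_of_injective (pow_inl_mul_inr_injective ha hb)).mono ?_
  have h0 (g : Coprod H₁ H₂) : lreg g (0 : lp (fun _ : Coprod H₁ H₂ => ℂ) 2) = 0 :=
    map_zero (lregHom _ g)
  rintro _ ⟨n, rfl⟩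
  change c ((inl a * inr b) ^ n) = 0
  induction n with
  | zero =>
    have h1 : c (1 * 1) = lregHom _ 1 (c 1) + c 1 := hc 1 1
    rw [mul_one, map_one, Module.End.one_apply, left_eq_add] at h1
    rw [pow_zero, h1]
  | succ n ih => rw [pow_succ, hc, hab, ih, h0, add_zero]

/-- On the free product of two finite cyclic groups, one of them with at least three elements,
there is a nonzero cocycle that vanishes on the product of the two generators. -/
theorem exists_cocycle_of_zpowers_eq_top [Finite H₁] [Finite H₂] (h₁ : 3 ≤ Nat.card H₁)
    (h₂ : 2 ≤ Nat.card H₂) {a : H₁} {b : H₂} (ha : Subgroup.zpowers a = ⊤)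
    (hb : Subgroup.zpowers b = ⊤) :
    ∃ c : Coprod H₁ H₂ → lp (fun _ : Coprod H₁ H₂ => ℂ) 2,
      (∀ g h, c (g * h) = lreg g (c h) + c g) ∧ c (inl a * inr b) = 0 ∧ c (inr b) ≠ 0 := by
  have := Fintype.ofFinite H₁
  have := Fintype.ofFinite H₂
  rw [Nat.card_eq_fintype_card] at h₁ h₂
  obtain ⟨u, hu, hu₁, hu₂⟩ := exists_harmonic h₁ h₂
  obtain ⟨f₁, hf₁⟩ := exists_lreg_sub_eq (inl : H₁ →* Coprod H₁ H₂) ha hu₁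
  obtain ⟨f₂, hf₂⟩ := exists_lreg_sub_eq (inr : H₂ →* Coprod H₁ H₂) hb hu₂
  let L := lregHom (Coprod H₁ H₂)
  have hf₁' : L (inl a) (L (inl a) f₁) - L (inl a) f₁ = L (inl a) u := by
    rw [← map_sub]
    exact congrArg _ hf₁
  have hf₂' : L (inr b) (-f₂) - -f₂ = -u := by
    rw [← hf₂, map_neg, neg_sub_neg, neg_sub]
    rfl
  obtain ⟨c, hc, hcl, hcr⟩ := exists_cocycle (L (inl a) f₁) (-f₂)
  have hcl' : c (inl a) = L (inl a) u := (hcl a).trans hf₁'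
  have hcr' : c (inr b) = -u := (hcr b).trans hf₂'
  refine ⟨c, hc, ?_, by simpa [hcr'] using hu⟩
  rw [hc, hcl', hcr']
  change L (inl a) (-u) + L (inl a) u = 0
  rw [map_neg, neg_add_cancel]

end Monoid.Coprod

/-- On a free product `H₁ ∗ H₂` of nontrivial countable groups with `H₁ ≄ ℤ/2ℤ`,
there is a `1`-cocycle with values in `ℓ²(H₁ ∗ H₂)` which is neither bounded
nor proper. -/
theorem free_product_cocycle_neither_bounded_nor_proper
    {H₁ H₂ : Type*} [Group H₁] [Group H₂] [Countable H₁] [Countable H₂]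
    [Nontrivial H₁] [Nontrivial H₂]
    (h2 : ¬ Nonempty (H₁ ≃* Multiplicative (ZMod 2))) :
    ∃ c : Monoid.Coprod H₁ H₂ → lp (fun _ : Monoid.Coprod H₁ H₂ => ℂ) 2,
      (∀ g h : Monoid.Coprod H₁ H₂, c (g * h) = lreg g (c h) + c g) ∧
      (¬ ∃ C : ℝ, ∀ g : Monoid.Coprod H₁ H₂, ‖c g‖ ≤ C) ∧
      ∃ C : ℝ, 0 ≤ C ∧ {g : Monoid.Coprod H₁ H₂ | ‖c g‖ ≤ C}.Infinite := by
  suffices h : ∃ c : Monoid.Coprod H₁ H₂ → lp (fun _ : Monoid.Coprod H₁ H₂ => ℂ) 2,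
      (∀ g h, c (g * h) = lreg g (c h) + c g) ∧ {g | c g = 0}.Infinite ∧ ∃ g, c g ≠ 0 by
    obtain ⟨c, hc, hz, g, hg⟩ := h
    exact ⟨c, hc, unbounded_and_not_proper_of_cocycle hc hz hg⟩
  have h0 (g : Monoid.Coprod H₁ H₂) :
      lreg g (0 : lp (fun _ : Monoid.Coprod H₁ H₂ => ℂ) 2) - 0 = 0 := by
    rw [sub_zero]
    exact map_zero (lregHom _ g)
  have left {A : Subgroup H₁} (hfin : (A : Set H₁).Finite) (hA : A ≠ ⊤) :
      ∃ c : Monoid.Coprod H₁ H₂ → lp (fun _ : Monoid.Coprod H₁ H₂ => ℂ) 2,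
        (∀ g h, c (g * h) = lreg g (c h) + c g) ∧ (∀ a ∈ A, c (Monoid.Coprod.inl a) = 0) ∧
          (∀ b, c (Monoid.Coprod.inr b) = 0) ∧ ∃ g, c g ≠ 0 := by
    obtain ⟨w, hw, h, hh⟩ := exists_lreg_fixed (Monoid.Coprod.inl_injective (N := H₂)) hfin hA
    obtain ⟨c, hc, hcl, hcr⟩ := Monoid.Coprod.exists_cocycle w 0
    exact ⟨c, hc, fun a ha => by rw [hcl, hw a ha, sub_self], fun b => (hcr b).trans (h0 _),
      Monoid.Coprod.inl h, by rwa [hcl, sub_ne_zero]⟩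
  have right {A : Subgroup H₂} (hfin : (A : Set H₂).Finite) (hA : A ≠ ⊤) :
      ∃ c : Monoid.Coprod H₁ H₂ → lp (fun _ : Monoid.Coprod H₁ H₂ => ℂ) 2,
        (∀ g h, c (g * h) = lreg g (c h) + c g) ∧ (∀ a, c (Monoid.Coprod.inl a) = 0) ∧
          (∀ b ∈ A, c (Monoid.Coprod.inr b) = 0) ∧ ∃ g, c g ≠ 0 := by
    obtain ⟨w, hw, h, hh⟩ := exists_lreg_fixed (Monoid.Coprod.inr_injective (M := H₁)) hfin hA
    obtain ⟨c, hc, hcl, hcr⟩ := Monoid.Coprod.exists_cocycle 0 w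
    exact ⟨c, hc, fun a => (hcl a).trans (h0 _), fun b hb => by rw [hcr, hw b hb, sub_self],
      Monoid.Coprod.inr h, by rwa [hcr, sub_ne_zero]⟩
  rcases finite_or_infinite H₁ with hf₁ | hf₁
  swap
  · obtain ⟨c, hc, hcl, -, hne⟩ := right (A := ⊥) (by simp) bot_ne_top
    refine ⟨c, hc, (Set.infinite_range_of_injective (Monoid.Coprod.inl_injective (N := H₂))).mono ?_, hne⟩
    rintro _ ⟨a, rfl⟩
    exact hcl a
  rcases finite_or_infinite H₂ with hf₂ | hf₂
  swap
  · obtain ⟨c, hc, -, hcr, hne⟩ := left (A := ⊥) (by simp) bot_ne_top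
    refine ⟨c, hc, (Set.infinite_range_of_injective (Monoid.Coprod.inr_injective (M := H₁))).mono ?_, hne⟩
    rintro _ ⟨b, rfl⟩
    exact hcr b
  obtain ⟨a, ha⟩ := exists_ne (1 : H₁)
  obtain ⟨b, hb⟩ := exists_ne (1 : H₂)
  by_cases hA : Subgroup.zpowers a = ⊤
  swap
  · obtain ⟨c, hc, hcl, hcr, hne⟩ := left (Set.toFinite _) hA
    refine ⟨c, hc, Monoid.Coprod.infinite_zeros_of_inl_mul_inr hc ha hb ?_, hne⟩
    rw [hc, hcr, hcl a (Subgroup.mem_zpowers a), add_zero]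
    exact map_zero (lregHom _ _)
  by_cases hB : Subgroup.zpowers b = ⊤
  swap
  · obtain ⟨c, hc, hcl, hcr, hne⟩ := right (Set.toFinite _) hB
    refine ⟨c, hc, Monoid.Coprod.infinite_zeros_of_inl_mul_inr hc ha hb ?_, hne⟩
    rw [hc, hcl, hcr b (Subgroup.mem_zpowers b), add_zero]
    exact map_zero (lregHom _ _)
  have hcard₁ : 3 ≤ Nat.card H₁ := by
    have h1 : 1 < Nat.card H₁ := Finite.one_lt_card
    have hne : Nat.card H₁ ≠ 2 := fun h => by
      have : Fact (Nat.Prime 2) := ⟨Nat.prime_two⟩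
      exact h2 ⟨mulEquivOfPrimeCardEq (p := 2) h (by simp)⟩
    lia
  obtain ⟨c, hc, hab, hne⟩ :=
    Monoid.Coprod.exists_cocycle_of_zpowers_eq_top hcard₁ Finite.one_lt_card hA hB
  exact ⟨c, hc, Monoid.Coprod.infinite_zeros_of_inl_mul_inr hc ha hb hab, _, hne⟩
end

section
/- Let G be a countable discrete group and H an infinite subgroup. Then H is wq-normal in G if and only if for every subgroup K with H ≤ K and K ≠ G there exists g ∈ G \ K such that gKg⁻¹ ∩ K is infinite. -/
/-- The subgroup `gHg⁻¹ ⊓ H` of `G`. -/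
def conjInter {G : Type*} [Group G] (g : G) (H : Subgroup G) : Subgroup G :=
  H.map (MulAut.conj g).toMonoidHom ⊓ H

/-- `H` is q-normal in `K` (for subgroups `H ≤ K` of an ambient group `G`):
`H` is infinite and `K` is generated by those of its elements `g` for which
`gHg⁻¹ ∩ H` is infinite. -/
def IsQNormalIn {G : Type*} [Group G] (H K : Subgroup G) : Prop :=
  H ≤ K ∧ (H : Set G).Infinite ∧
    K = Subgroup.closure {g : G | g ∈ K ∧ ((conjInter g H : Subgroup G) : Set G).Infinite}

/-- `H` is wq-normal in `K`: there are an ordinal `α` and an increasing chain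
`(f β)_{β ≤ α}` of subgroups with `f 0 = H` and `f α = K` such that for every
ordinal `γ` with `0 < γ ≤ α` the union `⋃_{β < γ} f β` is q-normal in `f γ`. -/
def IsWQNormalIn {G : Type*} [Group G] (H K : Subgroup G) : Prop :=
  ∃ (α : Ordinal.{0}) (f : Ordinal.{0} → Subgroup G), Monotone f ∧ f 0 = H ∧ f α = K ∧
    ∀ γ : Ordinal.{0}, 0 < γ → γ ≤ α →
      IsQNormalIn (⨆ β : Ordinal.{0}, ⨆ _ : β < γ, f β) (f γ)

theorem mem_conjInter {G : Type*} [Group G] {g x : G} {H : Subgroup G} :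
    x ∈ conjInter g H ↔ g⁻¹ * x * g ∈ H ∧ x ∈ H := by
  unfold conjInter
  refine and_congr_left fun _ => ⟨?_, fun h => ⟨_, h, by simp [mul_assoc]⟩⟩
  rintro ⟨y, hy, rfl⟩
  simpa [mul_assoc] using hy

theorem conjInter_mono {G : Type*} [Group G] (g : G) {H K : Subgroup G} (h : H ≤ K) :
    conjInter g H ≤ conjInter g K := fun x hx => by
  rw [mem_conjInter] at hx ⊢
  exact ⟨h hx.1, h hx.2⟩

theorem conjInter_of_mem {G : Type*} [Group G] {g : G} {H : Subgroup G} (h : g ∈ H) :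
    conjInter g H = H := by
  ext x
  rw [mem_conjInter]
  exact ⟨fun hx => hx.2, fun hx => ⟨H.mul_mem (H.mul_mem (H.inv_mem h) hx) h, hx⟩⟩

/-- The largest subgroup of `G` in which `H` can be q-normal: the one generated by all `g`
for which `gHg⁻¹ ∩ H` is infinite. -/
def qNormalizer {G : Type*} [Group G] (H : Subgroup G) : Subgroup G :=
  Subgroup.closure {g : G | ((conjInter g H : Subgroup G) : Set G).Infinite}

theorem mem_qNormalizer {G : Type*} [Group G] {g : G} {H K : Subgroup G} (hHK : H ≤ K)
    (hg : ((conjInter g H : Subgroup G) : Set G).Infinite) : g ∈ qNormalizer K :=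
  Subgroup.subset_closure (hg.mono (conjInter_mono g hHK))

theorem le_qNormalizer {G : Type*} [Group G] {H : Subgroup G} (hH : (H : Set G).Infinite) :
    H ≤ qNormalizer H := fun g hg =>
  mem_qNormalizer le_rfl (by rwa [conjInter_of_mem hg])

theorem isQNormalIn_qNormalizer {G : Type*} [Group G] {H : Subgroup G}
    (hH : (H : Set G).Infinite) : IsQNormalIn H (qNormalizer H) := by
  refine ⟨le_qNormalizer hH, hH, le_antisymm ?_ ?_⟩
  · exact Subgroup.closure_mono fun g hg => ⟨mem_qNormalizer le_rfl hg, hg⟩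
  · exact (Subgroup.closure_le _).2 fun g hg => hg.1

/-- The transfinite chain obtained from `H` by iterating `qNormalizer`. -/
noncomputable def qNormalizerChain {G : Type*} [Group G] (H : Subgroup G) (γ : Ordinal.{0}) :
    Subgroup G :=
  open Classical in
  if γ = 0 then H
  else qNormalizer (⨆ β : Ordinal.{0}, ⨆ _ : β < γ, qNormalizerChain H β)
termination_by γ

theorem qNormalizerChain_zero {G : Type*} [Group G] (H : Subgroup G) :
    qNormalizerChain H 0 = H := by
  rw [qNormalizerChain, if_pos rfl]

theorem qNormalizerChain_of_pos {G : Type*} [Group G] (H : Subgroup G) {γ : Ordinal.{0}}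
    (hγ : 0 < γ) : qNormalizerChain H γ =
      qNormalizer (⨆ β : Ordinal.{0}, ⨆ _ : β < γ, qNormalizerChain H β) := by
  rw [qNormalizerChain, if_neg hγ.ne']

theorem infinite_iSup_qNormalizerChain {G : Type*} [Group G] {H : Subgroup G}
    (hH : (H : Set G).Infinite) {γ : Ordinal.{0}} (hγ : 0 < γ) :
    ((⨆ β : Ordinal.{0}, ⨆ _ : β < γ, qNormalizerChain H β : Subgroup G) : Set G).Infinite :=
  hH.mono ((qNormalizerChain_zero H).ge.trans (le_iSup₂_of_le 0 hγ le_rfl))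

theorem qNormalizerChain_monotone {G : Type*} [Group G] {H : Subgroup G}
    (hH : (H : Set G).Infinite) : Monotone (qNormalizerChain H) := by
  refine monotone_iff_forall_lt.2 fun β γ h => ?_
  have hγ : 0 < γ := (zero_le (a := β)).trans_lt h
  rw [qNormalizerChain_of_pos H hγ]
  exact le_trans (le_iSup₂_of_le β h le_rfl)
    (le_qNormalizer (infinite_iSup_qNormalizerChain hH hγ))

theorem exists_qNormalizerChain_eq_top {G : Type*} [Group G] [Countable G] {H : Subgroup G}
    (hH : (H : Set G).Infinite)
    (h : ∀ K : Subgroup G, H ≤ K → K ≠ ⊤ →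
      ∃ g : G, g ∉ K ∧ ((conjInter g K : Subgroup G) : Set G).Infinite) :
    ∃ α : Ordinal.{0}, qNormalizerChain H α = ⊤ := by
  by_contra! hne
  have hmono := qNormalizerChain_monotone hH
  choose g hg hg' using fun γ => h (qNormalizerChain H γ)
    ((qNormalizerChain_zero H).ge.trans (hmono (zero_le (a := γ)))) (hne γ)
  have hmem : ∀ γ, g γ ∈ qNormalizerChain H (Order.succ γ) := fun γ => by
    rw [qNormalizerChain_of_pos H (Order.bot_lt_succ γ)]
    exact mem_qNormalizer (le_iSup₂_of_le γ (Order.lt_succ γ) le_rfl) (hg' γ)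
  have hinj : Function.Injective g :=
    Function.Injective.of_lt_imp_ne fun γ δ hlt heq =>
      hg δ (heq ▸ hmono (Order.succ_le_of_lt hlt) (hmem γ))
  exact not_injective_of_ordinal g hinj

theorem IsWQNormalIn.le_of_forall_mem {G : Type*} [Group G] {H L K : Subgroup G}
    (hHL : IsWQNormalIn H L) (hHK : H ≤ K)
    (hK : ∀ g : G, ((conjInter g K : Subgroup G) : Set G).Infinite → g ∈ K) : L ≤ K := by
  obtain ⟨α, f, -, h0, rfl, hq⟩ := hHL
  suffices ∀ γ ≤ α, f γ ≤ K from this α le_rfl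
  intro γ
  induction γ using WellFoundedLT.induction with
  | _ γ ih =>
    intro hγ
    rcases (zero_le (a := γ)).eq_or_lt with rfl | hpos
    · rwa [h0]
    · rw [(hq γ hpos hγ).2.2, Subgroup.closure_le]
      exact fun g hg => hK g (hg.2.mono (conjInter_mono g
        (iSup₂_le fun β hβ => ih β hβ (hβ.le.trans hγ))))

/-- An infinite subgroup `H` of a countable group `G` is wq-normal if and only if
every proper intermediate subgroup `H ≤ K ⊊ G` admits some `g ∈ G \ K` with
`gKg⁻¹ ∩ K` infinite. -/
theorem isWQNormal_iff_intermediate {G : Type*} [Group G] [Countable G]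
    (H : Subgroup G) (hH : (H : Set G).Infinite) :
    IsWQNormalIn H ⊤ ↔
      ∀ K : Subgroup G, H ≤ K → K ≠ ⊤ →
        ∃ g : G, g ∉ K ∧ ((conjInter g K : Subgroup G) : Set G).Infinite := by
  constructor
  · intro hwq K hHK hne
    by_contra! hK
    exact hne (top_le_iff.1 (hwq.le_of_forall_mem hHK fun g hg =>
      by_contra fun hgK => hg (hK g hgK)))
  · intro h
    obtain ⟨α, hα⟩ := exists_qNormalizerChain_eq_top hH h
    refine ⟨α, qNormalizerChain H, qNormalizerChain_monotone hH, qNormalizerChain_zero H, hα,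
      fun γ hγ _ => ?_⟩
    rw [qNormalizerChain_of_pos H hγ]
    exact isQNormalIn_qNormalizer (infinite_iSup_qNormalizerChain hH hγ)
end

section
/- Let G be a countable discrete group. If H is an infinite wq-normal subgroup of G and K is a subgroup with H ≤ K ≤ G, then K is wq-normal in G. In particular, every subgroup of G which contains an infinite normal subgroup of G is wq-normal in G. -/
theorem le_conjInter_of_mem {G : Type*} [Group G] {g : G} {H : Subgroup G} (hg : g ∈ H) :
    H ≤ conjInter g H := by
  intro x hx
  refine ⟨⟨g⁻¹ * x * g, H.mul_mem (H.mul_mem (H.inv_mem hg) hx) hg, ?_⟩, hx⟩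
  simp [mul_assoc]

theorem le_conjInter_of_normal {G : Type*} [Group G] (g : G) {N : Subgroup G} (hN : N.Normal) :
    N ≤ conjInter g N := by
  intro x hx
  refine ⟨⟨g⁻¹ * x * g, by simpa using hN.conj_mem x hx g⁻¹, ?_⟩, hx⟩
  simp [mul_assoc]

/-- q-normality survives enlarging the smaller subgroup, when the larger one is enlarged to the
join with a subgroup of it. -/
theorem IsQNormalIn.sup {G : Type*} [Group G] {H L H' K : Subgroup G} (h : IsQNormalIn H L)
    (hH : H ≤ H') (hK : K ≤ H') (hH' : H' ≤ L ⊔ K) : IsQNormalIn H' (L ⊔ K) := by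
  obtain ⟨-, hinf, hL⟩ := h
  have hinf' : (H' : Set G).Infinite := hinf.mono hH
  refine ⟨hH', hinf', le_antisymm (sup_le ?_ ?_) ?_⟩
  · conv_lhs => rw [hL]
    exact Subgroup.closure_mono fun g hg =>
      ⟨le_sup_left (a := L) hg.1, hg.2.mono (conjInter_mono g hH)⟩
  · exact fun k hk => Subgroup.subset_closure
      ⟨le_sup_right (a := L) hk, hinf'.mono (le_conjInter_of_mem (hK hk))⟩
  · exact (Subgroup.closure_le _).2 fun g hg => hg.1

theorem IsQNormalIn.isWQNormalIn {G : Type*} [Group G] {H K : Subgroup G}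
    (h : IsQNormalIn H K) : IsWQNormalIn H K := by
  refine ⟨1, fun β => if β = 0 then H else K, ?_, by simp, by simp, ?_⟩
  · intro a b hab
    rcases eq_or_ne a 0 with rfl | ha
    · rcases eq_or_ne b 0 with rfl | hb
      · exact le_rfl
      · simpa [hb] using h.1
    · have hb : b ≠ 0 := ((pos_iff_ne_zero.2 ha).trans_le hab).ne'
      simp [ha, hb]
  · intro γ h0 h1
    obtain rfl : γ = 1 := le_antisymm h1 (Order.one_le_iff_pos.2 h0)
    simpa using h

theorem IsWQNormalIn.sup {G : Type*} [Group G] {H L K : Subgroup G} (h : IsWQNormalIn H L)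
    (hHK : H ≤ K) : IsWQNormalIn K (L ⊔ K) := by
  obtain ⟨α, f, hf, h0, hα, hq⟩ := h
  refine ⟨α, fun β => f β ⊔ K, fun a b hab => sup_le_sup_right (hf hab) K,
    by simpa [h0] using hHK, by simp [hα], fun γ hγ hγα => (hq γ hγ hγα).sup ?_ ?_ ?_⟩
  · exact iSup₂_mono fun _ _ => le_sup_left
  · exact le_sup_right.trans (le_iSup₂_of_le 0 hγ le_rfl)
  · exact iSup₂_le fun β hβ => sup_le_sup_right (hf hβ.le) K

theorem isWQNormalIn_top_of_normal {G : Type*} [Group G] {N : Subgroup G} (hN : N.Normal)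
    (hinf : (N : Set G).Infinite) : IsWQNormalIn N ⊤ := by
  refine IsQNormalIn.isWQNormalIn ⟨le_top, hinf, le_antisymm (fun g hg => ?_) le_top⟩
  exact Subgroup.subset_closure ⟨hg, hinf.mono (le_conjInter_of_normal g hN)⟩

/-- If `H` is an infinite wq-normal subgroup of a countable group `G` and
`H ≤ K`, then `K` is wq-normal in `G`.  In particular every subgroup containing
an infinite normal subgroup of `G` is wq-normal in `G`. -/
theorem isWQNormal_of_le {G : Type*} [Group G] [Countable G] (K : Subgroup G) :
    (∀ H : Subgroup G, (H : Set G).Infinite → IsWQNormalIn H ⊤ → H ≤ K →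
      IsWQNormalIn K ⊤) ∧
    ((∃ N : Subgroup G, N.Normal ∧ (N : Set G).Infinite ∧ N ≤ K) →
      IsWQNormalIn K ⊤) := by
  have key : ∀ H : Subgroup G, IsWQNormalIn H ⊤ → H ≤ K → IsWQNormalIn K ⊤ :=
    fun H hH hHK => by simpa using hH.sup hHK
  exact ⟨fun H _ => key H, fun ⟨N, hN, hinf, hNK⟩ =>
    key N (isWQNormalIn_top_of_normal hN hinf) hNK⟩
end

section
/- Let G be a countable discrete group and H ≤ G a subgroup of infinite index. Let X be the space of all functions from the coset space G/H to [0,1], equipped with the infinite product μ of Lebesgue measure on [0,1] over the index set G/H, and let G act on X by permuting coordinates via left translation on G/H: (g·x)(c) = x(g⁻¹·c). Then: (1) this action preserves μ; (2) the action of G is ergodic, i.e., every G-invariant measurable subset of X has measure 0 or 1; (3) the restricted action of H is not ergodic — indeed, for every t ∈ [0,1] there exists an H-invariant measurable subset of X of measure t (so the H-action has a continuum of ergodic components). -/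
open MeasureTheory unitInterval
open scoped ENNReal

open scoped Pointwise in
/-- In a transitive action on an infinite set, every finite set can be moved off itself. -/
theorem MulAction.exists_smul_notMem_of_infinite {G α : Type*} [Group G] [MulAction G α]
    [MulAction.IsPretransitive G α] [Infinite α] (F : Finset α) :
    ∃ g : G, ∀ a ∈ F, g • a ∉ F := by
  classical
  by_contra! h
  choose k hk using fun p : α × α => MulAction.exists_smul_eq G p.1 p.2
  have hcov : ⋃ p ∈ F ×ˢ F, k p • (MulAction.stabilizer G p.1 : Set G) = Set.univ := by
    refine Set.eq_univ_of_forall fun g => ?_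
    obtain ⟨a, ha, hga⟩ := h g
    simp only [Set.mem_iUnion]
    refine ⟨(a, g • a), Finset.mk_mem_product ha hga, ?_⟩
    rw [mem_leftCoset_iff, SetLike.mem_coe, MulAction.mem_stabilizer_iff, mul_smul,
      inv_smul_eq_iff]
    exact (hk (a, g • a)).symm
  obtain ⟨p, -, hp⟩ := Subgroup.exists_finiteIndex_of_leftCoset_cover hcov
  apply hp.index_ne_zero
  rw [MulAction.index_stabilizer_of_transitive, Nat.card_eq_zero_of_infinite]

section Shift

variable {G ι X : Type*} [Group G] [MulAction G ι] [MeasurableSpace X]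

/-- Permuting the coordinates of a power of a probability space preserves the product measure. -/
theorem measurePreserving_shift_infinitePi (ν : Measure X) [IsProbabilityMeasure ν] (g : G) :
    MeasurePreserving (fun (x : ι → X) (c : ι) => x (g⁻¹ • c))
      (Measure.infinitePi fun _ => ν) (Measure.infinitePi fun _ => ν) :=
  ⟨by fun_prop, Measure.map_infinitePi_infinitePi_of_inj (P := fun _ : ι => ν)
    (MulAction.injective g⁻¹)⟩

open ProbabilityTheory in
/-- For a transitive action on an infinite index set, every measurable cylinder is independent
of one of its translates. -/
theorem exists_measureReal_inter_shift_preimage_eq_mul [MulAction.IsPretransitive G ι]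
    [Infinite ι] (ν : Measure X) [IsProbabilityMeasure ν] {C : Set (ι → X)}
    (hC : C ∈ measurableCylinders fun _ : ι => X) :
    ∃ g : G, (Measure.infinitePi fun _ => ν).real
      (C ∩ (fun (x : ι → X) (c : ι) => x (g⁻¹ • c)) ⁻¹' C) =
        (Measure.infinitePi fun _ => ν).real C * (Measure.infinitePi fun _ => ν).real C := by
  classical
  obtain ⟨F, S, hS, rfl⟩ := (mem_measurableCylinders C).1 hC
  obtain ⟨g, hg⟩ := MulAction.exists_smul_notMem_of_infinite (G := G) F
  refine ⟨g⁻¹, ?_⟩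
  have hdisj : Disjoint F (F.image (g • ·)) := by
    rw [Finset.disjoint_right]
    simpa using hg
  have hind := (iIndepFun_infinitePi (P := fun _ : ι => ν) (X := fun _ x => x)
    fun _ => measurable_id).indepFun_finset F (F.image (g • ·)) hdisj fun i => by fun_prop
  let ψ : (F.image (g • ·) → X) → F → X :=
    fun y i => y ⟨g • (i : ι), Finset.mem_image_of_mem _ i.2⟩
  have hψ : Measurable ψ := by fun_prop
  have hmul := (hind.comp measurable_id hψ).measure_inter_preimage_eq_mul S S hS hS
  have hpre := (measurePreserving_shift_infinitePi (ι := ι) ν g⁻¹).measureReal_preimage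
    (hS.cylinder F).nullMeasurableSet
  simp only [inv_inv] at hpre ⊢
  conv_rhs => enter [2]; rw [← hpre]
  simp only [measureReal_def, ← ENNReal.toReal_mul]
  exact congrArg ENNReal.toReal hmul

/-- For a transitive action on an infinite index set, shift-invariant measurable sets are null or
conull for the product measure. -/
theorem infinitePi_eq_zero_or_one_of_shift_invariant [MulAction.IsPretransitive G ι]
    [Infinite ι] (ν : Measure X) [IsProbabilityMeasure ν] {A : Set (ι → X)}
    (hA : MeasurableSet A)
    (hinv : ∀ g : G, (fun (x : ι → X) (c : ι) => x (g⁻¹ • c)) ⁻¹' A = A) :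
    Measure.infinitePi (fun _ => ν) A = 0 ∨ Measure.infinitePi (fun _ => ν) A = 1 := by
  set μ : Measure (ι → X) := Measure.infinitePi fun _ => ν
  have hdense : μ.MeasureDense (measurableCylinders fun _ : ι => X) :=
    .of_generateFrom_isSetAlgebra_finite _ isSetAlgebra_measurableCylinders
      generateFrom_measurableCylinders.symm
  have key : ∀ ε : ℝ, 0 < ε → |μ.real A - μ.real A * μ.real A| ≤ 0 + ε := by
    intro ε hε
    obtain ⟨C, hC, hAC⟩ := hdense.approx A hA (measure_ne_top _ _) (ε / 4) (by positivity)
    have hCm : MeasurableSet C := hdense.measurable C hC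
    replace hAC : μ.real (symmDiff A C) < ε / 4 := by
      rw [measureReal_def]
      exact ENNReal.toReal_lt_of_lt_ofReal hAC
    obtain ⟨g, hg⟩ := exists_measureReal_inter_shift_preimage_eq_mul (G := G) ν hC
    set T : (ι → X) → ι → X := fun x c => x (g⁻¹ • c)
    have hT : MeasurePreserving T μ μ := measurePreserving_shift_infinitePi ν g
    have hAC' : μ.real (symmDiff A (T ⁻¹' C)) = μ.real (symmDiff A C) := by
      rw [← hT.measureReal_preimage (hA.symmDiff hCm).nullMeasurableSet, Set.preimage_symmDiff,
        hinv g]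
    have hsub : symmDiff A (C ∩ T ⁻¹' C) ⊆ symmDiff A C ∪ symmDiff A (T ⁻¹' C) := by
      intro x
      simp only [Set.mem_symmDiff, Set.mem_inter_iff, Set.mem_union]
      tauto
    have h1 : μ.real (symmDiff A (C ∩ T ⁻¹' C)) ≤ ε / 4 + ε / 4 :=
      (measureReal_mono hsub).trans <| (measureReal_union_le _ _).trans <| by linarith
    have h2 := abs_measureReal_sub_le_measureReal_symmDiff (μ := μ) hA.nullMeasurableSet
      (hCm.inter (hT.measurable hCm)).nullMeasurableSet
    have h3 := abs_measureReal_sub_le_measureReal_symmDiff (μ := μ) hA.nullMeasurableSet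
      hCm.nullMeasurableSet
    rw [hg] at h2
    have hA0 : 0 ≤ μ.real A := measureReal_nonneg
    have hA1 : μ.real A ≤ 1 := measureReal_le_one
    have hC0 : 0 ≤ μ.real C := measureReal_nonneg
    have hC1 : μ.real C ≤ 1 := measureReal_le_one
    rw [abs_le] at h2 h3 ⊢
    constructor <;> nlinarith
  have h0 : μ.real A * (1 - μ.real A) = 0 := by
    linarith [abs_nonpos_iff.1 (le_of_forall_pos_le_add key)]
  rcases mul_eq_zero.1 h0 with h | h
  · exact .inl ((measureReal_eq_zero_iff).1 h)
  · right
    rw [← ENNReal.toReal_eq_one_iff, ← measureReal_def]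
    linarith

end Shift

/-- Let `H` be a subgroup of infinite index of a countable group `G`, and let `μ` be
the product of Lebesgue measure on the product space `(G/H) → [0,1]`, on which `G`
acts by permuting coordinates via left translation on `G/H`.  Then the action
preserves `μ` and is ergodic, while the restricted `H`-action admits invariant sets
of every measure `t ∈ [0,1]` (so it has a continuum of ergodic components). -/
theorem product_action_ergodic_not_restricted {G : Type*} [Group G] [Countable G]
    (H : Subgroup G) (hGH : Infinite (G ⧸ H))
    (μ : Measure ((G ⧸ H) → I)) [IsProbabilityMeasure μ]
    (hμ : ∀ (s : Finset (G ⧸ H)) (t : (G ⧸ H) → Set I), (∀ c, MeasurableSet (t c)) →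
      μ {x : (G ⧸ H) → I | ∀ c ∈ s, x c ∈ t c} = ∏ c ∈ s, volume (t c)) :
    (∀ g : G,
      MeasurePreserving (fun (x : (G ⧸ H) → I) (c : G ⧸ H) => x (g⁻¹ • c)) μ μ) ∧
    (∀ A : Set ((G ⧸ H) → I), MeasurableSet A →
      (∀ g : G, (fun (x : (G ⧸ H) → I) (c : G ⧸ H) => x (g⁻¹ • c)) ⁻¹' A = A) →
      μ A = 0 ∨ μ A = 1) ∧
    (∀ t : ℝ, t ∈ Set.Icc (0 : ℝ) 1 → ∃ A : Set ((G ⧸ H) → I), MeasurableSet A ∧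
      (∀ h : G, h ∈ H → (fun (x : (G ⧸ H) → I) (c : G ⧸ H) => x (h⁻¹ • c)) ⁻¹' A = A) ∧
      μ A = ENNReal.ofReal t) := by
  have hμ' : μ = Measure.infinitePi fun _ => (volume : Measure I) := Measure.eq_infinitePi _ hμ
  refine ⟨fun g => ?_, fun A hA hinv => ?_, fun t ht => ?_⟩
  · rw [hμ']
    exact measurePreserving_shift_infinitePi volume g
  · rw [hμ']
    exact infinitePi_eq_zero_or_one_of_shift_invariant volume hA hinv
  · refine ⟨(fun x => x ((1 : G) : G ⧸ H)) ⁻¹' Set.Iic ⟨t, ht⟩,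
      measurable_pi_apply _ measurableSet_Iic, fun h hh => ?_, ?_⟩
    · have hfix : h⁻¹ • ((1 : G) : G ⧸ H) = ((1 : G) : G ⧸ H) := by
        rw [MulAction.Quotient.smul_coe, smul_eq_mul, mul_one, QuotientGroup.eq]
        simpa using hh
      ext x
      simp only [Set.mem_preimage, hfix]
    · have := hμ {((1 : G) : G ⧸ H)} (fun _ => Set.Iic ⟨t, ht⟩) fun _ => measurableSet_Iic
      simpa [Set.preimage] using this
end

section
/- Let G be a torsionfree countable discrete group and H a nontrivial subgroup which is power-absorbing, i.e., for every g ∈ G there exists an integer n ≥ 1 with gⁿ ∈ H. Then H is s-normal in G: H is infinite and gHg⁻¹ ∩ H is infinite for every g ∈ G. -/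
/-- `H` is s-normal in `K` (for subgroups `H ≤ K` of an ambient group `G`):
`H` is infinite and `gHg⁻¹ ∩ H` is infinite for every `g ∈ K`. -/
def IsSNormalIn {G : Type*} [Group G] (H K : Subgroup G) : Prop :=
  H ≤ K ∧ (H : Set G).Infinite ∧
    ∀ g ∈ K, ((conjInter g H : Subgroup G) : Set G).Infinite

/-- In a torsionfree group, a subgroup with a nontrivial element is infinite. -/
theorem Subgroup.infinite_of_mem_of_torsionfree {G : Type*} [Group G]
    (htf : ∀ g : G, g ≠ 1 → ∀ n : ℕ, n ≠ 0 → g ^ n ≠ 1)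
    (K : Subgroup G) {x : G} (hx : x ∈ K) (hx1 : x ≠ 1) : (K : Set G).Infinite := by
  refine Set.infinite_of_injective_forall_mem (f := fun n : ℕ => x ^ n) ?_ fun n => pow_mem hx n
  rw [injective_pow_iff_not_isOfFinOrder, isOfFinOrder_iff_pow_eq_one]
  rintro ⟨n, hn, h⟩
  exact htf x hx1 n hn.ne' h

/-- In a torsionfree countable group, every nontrivial power-absorbing subgroup is
s-normal. -/
theorem powerAbsorbing_sNormal {G : Type*} [Group G] [Countable G]
    (htf : ∀ g : G, g ≠ 1 → ∀ n : ℕ, n ≠ 0 → g ^ n ≠ 1)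
    (H : Subgroup G) (hH : H ≠ ⊥)
    (habs : ∀ g : G, ∃ n : ℕ, 1 ≤ n ∧ g ^ n ∈ H) :
    IsSNormalIn H ⊤ := by
  obtain ⟨h, hh, h1⟩ := H.bot_or_exists_ne_one.resolve_left hH
  refine ⟨le_top, H.infinite_of_mem_of_torsionfree htf hh h1, fun g _ => ?_⟩
  obtain ⟨n, hn, hmem⟩ := habs (g * h * g⁻¹)
  refine (conjInter g H).infinite_of_mem_of_torsionfree htf (x := (g * h * g⁻¹) ^ n)
    ⟨⟨h ^ n, pow_mem hh n, by simp [conj_pow]⟩, hmem⟩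
    (htf _ (fun e => h1 (conj_eq_one_iff.mp e)) n (by omega))
end

section
/- Let F be a group, S ⊆ F a subset, N the normal closure of S in F, and π : F → F/N the quotient map. Let M be an abelian group with an action of F/N by additive automorphisms, regarded as an F-module via π. Then a 1-cocycle c : F → M satisfies c(s) = 0 for all s ∈ S if and only if there is a (necessarily unique) 1-cocycle c̄ : F/N → M with c = c̄ ∘ π. (In particular, a cocycle on F vanishing on each s ∈ S vanishes on every conjugate fsf⁻¹, since c(fsf⁻¹) = (1 − π(fsf⁻¹))·c(f) + f·c(s).) -/
/-- A `1`-cocycle pulled back along `π : F →* Q` that vanishes on a subset `S` of `ker π`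
vanishes on the normal closure of `S`. -/
theorem cocycle_eq_zero_of_mem_normalClosure {F Q M : Type*} [Group F] [Group Q]
    [AddCommGroup M] [DistribMulAction Q M] (π : F →* Q) {c : F → M}
    (hc : ∀ f g : F, c (f * g) = π f • c g + c f) {S : Set F}
    (hS : ∀ s ∈ S, π s = 1 ∧ c s = 0) {n : F} (hn : n ∈ Subgroup.normalClosure S) :
    c n = 0 := by
  have c_one : c 1 = 0 := by simpa using hc 1 1
  let K : Subgroup F :=
    { carrier := {f | π f = 1 ∧ c f = 0}
      one_mem' := ⟨map_one π, c_one⟩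
      mul_mem' := by
        rintro a b ⟨ha, ha'⟩ ⟨hb, hb'⟩
        exact ⟨by simp [ha, hb], by simp [hc, ha', hb']⟩
      inv_mem' := by
        rintro a ⟨ha, ha'⟩
        refine ⟨by simp [ha], ?_⟩
        simpa [c_one, ha'] using (hc a⁻¹ a).symm }
  have hK : K.Normal := ⟨by
    rintro a ⟨ha, ha'⟩ g
    refine ⟨by simp [ha], ?_⟩
    rw [mul_assoc, hc, hc a, ha, ha', one_smul, add_zero, ← hc, mul_inv_cancel, c_one]⟩
  exact (Subgroup.normalClosure_le_normal (N := K) hS hn).2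


/-- Let `N` be the normal closure of `S ⊆ F`, and let `M` be a module over `F ⧸ N`
(regarded as an `F`-module via the quotient map `π`).  A `1`-cocycle `c : F → M`
vanishes on `S` if and only if it factors (necessarily uniquely) as `c = c' ∘ π`
for a `1`-cocycle `c'` on `F ⧸ N`. -/
theorem cocycle_factors_through_quotient {F M : Type*} [Group F] [AddCommGroup M]
    (S : Set F) [DistribMulAction (F ⧸ Subgroup.normalClosure S) M]
    (c : F → M)
    (hc : ∀ f g : F,
      c (f * g) = (QuotientGroup.mk f : F ⧸ Subgroup.normalClosure S) • c g + c f) :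
    (∀ s ∈ S, c s = 0) ↔
      ∃! c' : F ⧸ Subgroup.normalClosure S → M,
        (∀ a b : F ⧸ Subgroup.normalClosure S, c' (a * b) = a • c' b + c' a) ∧
        ∀ f : F, c f = c' (QuotientGroup.mk f) := by
  constructor
  · intro hS
    have hN {n : F} (hn : n ∈ Subgroup.normalClosure S) : c n = 0 :=
      cocycle_eq_zero_of_mem_normalClosure (QuotientGroup.mk' _) hc
        (fun s hs => ⟨(QuotientGroup.eq_one_iff s).2 (Subgroup.subset_normalClosure hs), hS s hs⟩)
        hn
    refine ⟨fun q => Quotient.liftOn' q c fun a b hab => ?_, ⟨?_, fun f => rfl⟩, ?_⟩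
    · have h := hc a (a⁻¹ * b)
      rw [hN (QuotientGroup.leftRel_apply.1 hab), smul_zero, zero_add, mul_inv_cancel_left] at h
      exact h.symm
    · rintro ⟨a⟩ ⟨b⟩
      exact hc a b
    · rintro d ⟨-, hd⟩
      ext ⟨f⟩
      exact (hd f).symm
  · rintro ⟨d, ⟨hd, hcd⟩, -⟩ s hs
    have d_one : d 1 = 0 := by simpa using hd 1 1
    rw [hcd, (QuotientGroup.eq_one_iff s).2 (Subgroup.subset_normalClosure hs), d_one]
end

section
/- Let A and B be groups, let A ∗ B denote their free product, and let M be an abelian group with an action of A ∗ B by additive automorphisms. Then the restriction map Z¹(A ∗ B; M) → Z¹(A; M) ⊕ Z¹(B; M) is a bijection: for every pair of 1-cocycles c_A : A → M and c_B : B → M there is a unique 1-cocycle c : A ∗ B → M restricting to c_A on A and to c_B on B. -/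
open Monoid.Coprod

section CocycleHom

variable {G H M : Type*} [Group G] [Group H] [AddCommGroup M] [DistribMulAction G M]

/-- The action of `G` on `M`, as automorphisms of `Multiplicative M`. -/
def distribMulActionToMulAut (G M : Type*) [Group G] [AddCommGroup M] [DistribMulAction G M] :
    G →* MulAut (Multiplicative M) :=
  (MulAutMultiplicative M).symm.toMonoidHom.comp (DistribMulAction.toAddAut G M)

/-- A cocycle `f : H → M` along `φ : H →* G` is the same as a lift of `φ` to the
semidirect product `M ⋊ G`; this is the lift `h ↦ (f h, φ h)`. -/
def cocycleHom (φ : H →* G) (f : H → M) (hf : ∀ h h', f (h * h') = φ h • f h' + f h) :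
    H →* Multiplicative M ⋊[distribMulActionToMulAut G M] G :=
  MonoidHom.mk' (fun h => ⟨Multiplicative.ofAdd (f h), φ h⟩) fun h h' =>
    SemidirectProduct.ext
      (congrArg Multiplicative.ofAdd ((hf h h').trans (add_comm _ _))) (map_mul φ h h')

theorem toAdd_left_map_mul
    (F : H →* Multiplicative M ⋊[distribMulActionToMulAut G M] G) (h h' : H) :
    (F (h * h')).left.toAdd = (F h).right • (F h').left.toAdd + (F h).left.toAdd := by
  rw [map_mul, add_comm]
  rfl

end CocycleHom


/-- For groups `A`, `B` and a module `M` over the free product `A ∗ B`, restriction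
is a bijection `Z¹(A ∗ B; M) ≃ Z¹(A; M) ⊕ Z¹(B; M)`: every pair of `1`-cocycles on
`A` and on `B` extends uniquely to a `1`-cocycle on `A ∗ B`. -/
theorem cocycle_free_product_unique_extension {A B M : Type*} [Group A] [Group B]
    [AddCommGroup M] [DistribMulAction (Monoid.Coprod A B) M]
    (cA : A → M) (cB : B → M)
    (hcA : ∀ a a' : A,
      cA (a * a') = (Monoid.Coprod.inl a : Monoid.Coprod A B) • cA a' + cA a)
    (hcB : ∀ b b' : B,
      cB (b * b') = (Monoid.Coprod.inr b : Monoid.Coprod A B) • cB b' + cB b) :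
    ∃! c : Monoid.Coprod A B → M,
      (∀ x y : Monoid.Coprod A B, c (x * y) = x • c y + c x) ∧
      (∀ a : A, c (Monoid.Coprod.inl a) = cA a) ∧
      (∀ b : B, c (Monoid.Coprod.inr b) = cB b) := by
  let F : Monoid.Coprod A B →*
      Multiplicative M ⋊[distribMulActionToMulAut (Monoid.Coprod A B) M] Monoid.Coprod A B :=
    lift (cocycleHom inl cA hcA) (cocycleHom inr cB hcB)
  have hF : ∀ x, (F x).right = x := fun x =>
    DFunLike.congr_fun (hom_ext rfl rfl :
      SemidirectProduct.rightHom.comp F = MonoidHom.id (Monoid.Coprod A B)) x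
  refine ⟨fun x => (F x).left.toAdd, ⟨fun x y => ?_, fun _ => rfl, fun _ => rfl⟩, ?_⟩
  · exact (toAdd_left_map_mul F x y).trans (by rw [hF])
  · rintro c ⟨hc, hA, hB⟩
    have h : cocycleHom (MonoidHom.id _) c hc = F := hom_ext
      (MonoidHom.ext fun a => SemidirectProduct.ext (congrArg Multiplicative.ofAdd (hA a)) rfl)
      (MonoidHom.ext fun b => SemidirectProduct.ext (congrArg Multiplicative.ofAdd (hB b)) rfl)
    funext x
    exact congrArg (fun K => (K x).left.toAdd) h
end
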